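/- arXiv:2108.07991 — 3 statements merged into one kernel-verified Lean document; each statement's English description precedes it below -/
import Mathlib

section
/- Let R be a commutative Noetherian local ring, M a nonzero finitely generated R-module, and 𝔞 an ideal of R. If M is Tor-rigid (i.e., whenever Tor_i^R(M,N)=0 for some finitely generated N and some i≥1, then Tor_j^R(M,N)=0 for all j≥i), then depth_R(𝔞, M) ≤ depth_R(𝔞, R). -/
open CategoryTheory IsLocalRing

section Defs
variable (R : Type) [CommRing R]

/-- vanishing of `Tor_n(M, N)` -/
noncomputable abbrev TorZero [IsNoetherianRing R] (n : ℕ) (M N : ModuleCat.{0} R) : Prop :=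
  Subsingleton (((Tor (ModuleCat.{0} R) n).obj M).obj N)

/-- vanishing of `Ext^n(M, N)` -/
noncomputable abbrev ExtZero (n : ℕ) (M N : ModuleCat.{0} R) : Prop :=
  Subsingleton (((Ext R (ModuleCat.{0} R) n).obj (Opposite.op M)).obj N)

/-- `x` annihilates `Ext^n(M, N)` -/
noncomputable abbrev SMulExtZero (x : R) (n : ℕ) (M N : ModuleCat.{0} R) : Prop :=
  ∀ e : ((Ext R (ModuleCat.{0} R) n).obj (Opposite.op M)).obj N, x • e = 0

/-- `M` is a minimal first syzygy `Ω N` of `N` over the local ring `R`: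
the kernel of a minimal free cover of `N`. -/
def IsSyzygyOf [IsLocalRing R] (N M : ModuleCat.{0} R) : Prop :=
  ∃ (q : ℕ) (g : (Fin q → R) →ₗ[R] N), Function.Surjective g ∧
    (LinearMap.ker g : Submodule R (Fin q → R)) ≤ (maximalIdeal R) • ⊤ ∧
    Nonempty (M ≃ₗ[R] LinearMap.ker g)

/-- `M` is a minimal `n`-th syzygy `Ω^n N` of `N` (with `Ω^0 N = N`). -/
def IsNthSyzygyOf [IsLocalRing R] : ℕ → ModuleCat.{0} R → ModuleCat.{0} R → Prop
  | 0, N, M => Nonempty (M ≃ₗ[R] N)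
  | (n+1), N, M => ∃ K : ModuleCat.{0} R, IsSyzygyOf R N K ∧ IsNthSyzygyOf n K M

/-- `M` and `N` are stably isomorphic (isomorphic up to free direct summands). -/
def StablyIso (M N : ModuleCat.{0} R) : Prop :=
  ∃ p q : ℕ, Nonempty ((↥M × (Fin p → R)) ≃ₗ[R] (↥N × (Fin q → R)))

/-- Tor-rigidity: one vanishing Tor (against any f.g. module) forces all higher ones. -/
noncomputable def TorRigid [IsNoetherianRing R] (M : ModuleCat.{0} R) : Prop :=
  ∀ (N : ModuleCat.{0} R), Module.Finite R N →
    ∀ i : ℕ, 1 ≤ i → TorZero R i M N → ∀ j, i ≤ j → TorZero R j M N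

/-- `n`-Tor-rigidity: `n` consecutive vanishing Tor's force all higher ones. -/
noncomputable def NTorRigid [IsNoetherianRing R] (n : ℕ) (M : ModuleCat.{0} R) : Prop :=
  ∀ (N : ModuleCat.{0} R), Module.Finite R N → ∀ t : ℕ,
    (∀ i, t + 1 ≤ i → i ≤ t + n → TorZero R i M N) → ∀ j, t + 1 ≤ j → TorZero R j M N

/-- the `𝔞`-depth of `M`: `∞` if `𝔞M = M`, otherwise the supremum (= common length) of
maximal `M`-regular sequences contained in `𝔞`. -/
noncomputable def edepth (𝔞 : Ideal R) (M : Type) [AddCommGroup M] [Module R M] : ℕ∞ :=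
  letI := Classical.dec (𝔞 • (⊤ : Submodule R M) = ⊤)
  if 𝔞 • (⊤ : Submodule R M) = ⊤ then ⊤
  else sSup {n : ℕ∞ | ∃ rs : List R, (rs.length : ℕ∞) = n ∧ (∀ r ∈ rs, r ∈ 𝔞) ∧
    RingTheory.Sequence.IsRegular M rs}

/-- `T` is an Auslander transpose of `N`, computed from a minimal free presentation. -/
def IsTransposeOf [IsLocalRing R] (N T : ModuleCat.{0} R) : Prop :=
  ∃ (q p : ℕ) (g : (Fin q → R) →ₗ[R] N) (f : (Fin p → R) →ₗ[R] (Fin q → R)),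
    Function.Surjective g ∧
    LinearMap.range f = LinearMap.ker g ∧
    (LinearMap.ker g : Submodule R (Fin q → R)) ≤ (maximalIdeal R) • ⊤ ∧
    (LinearMap.ker f : Submodule R (Fin p → R)) ≤ (maximalIdeal R) • ⊤ ∧
    Nonempty (T ≃ₗ[R] (Module.Dual R (Fin p → R) ⧸ LinearMap.range f.dualMap))

/-- `depth (R_𝔭)`, the depth of the local ring `R_𝔭`. -/
noncomputable def depthLoc (𝔭 : Ideal R) [𝔭.IsPrime] : ℕ∞ :=
  edepth (Localization.AtPrime 𝔭) (maximalIdeal (Localization.AtPrime 𝔭)) (Localization.AtPrime 𝔭)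

/-- `depth_{R_𝔭} (M_𝔭)`, the depth of the localized module over the localized ring. -/
noncomputable def primeDepth (𝔭 : Ideal R) [𝔭.IsPrime] (M : Type) [AddCommGroup M]
    [Module R M] : ℕ∞ :=
  edepth (Localization.AtPrime 𝔭) (maximalIdeal (Localization.AtPrime 𝔭))
    (LocalizedModule 𝔭.primeCompl M)

/-- A Noetherian local ring is Gorenstein iff `R` has finite injective dimension as an
`R`-module, i.e. `Ext^i(k, R) = 0` for all sufficiently large `i`. -/
noncomputable def IsGorensteinLocal [IsLocalRing R] : Prop :=
  ∃ d : ℕ, ∀ i : ℕ, d < i → ExtZero R i (ModuleCat.of R (R ⧸ maximalIdeal R)) (ModuleCat.of R R)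

/-- An unramified regular local ring: the maximal ideal is generated by `dim R` elements, and
no rational prime that is a nonzero element of the maximal ideal lies in its square. -/
def IsUnramifiedRegularLocal [IsLocalRing R] : Prop :=
  (∃ s : Finset R, Ideal.span (s : Set R) = maximalIdeal R ∧
    (s.card : WithBot ℕ∞) = ringKrullDim R) ∧
  ∀ p : ℕ, p.Prime → (p : R) ≠ 0 → (p : R) ∈ maximalIdeal R → (p : R) ∉ (maximalIdeal R) ^ 2

end Defs

open TensorProduct in
/-- Every short exact sequence ending in `C` stays exact after tensoring with `M`. -/
def TOne (R : Type) [CommRing R] (M : Type) [AddCommGroup M] [Module R M]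
    (C : Type) [AddCommGroup C] [Module R C] : Prop :=
  ∀ (A B : Type) [AddCommGroup A] [AddCommGroup B] [Module R A] [Module R B]
    (i : A →ₗ[R] B) (p : B →ₗ[R] C), Function.Injective i → Function.Exact i p →
    Function.Surjective p → Function.Injective (i.lTensor M)

section TOneSec
variable {R : Type} [CommRing R] {M : Type} [AddCommGroup M] [Module R M]
  {A B C F : Type} [AddCommGroup A] [Module R A] [AddCommGroup B] [Module R B]
  [AddCommGroup C] [Module R C] [AddCommGroup F] [Module R F]

lemma exists_proj_cover (B : Type) [AddCommGroup B] [Module R B] :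
    ∃ (F : Type) (_ : AddCommGroup F) (_ : Module R F) (_ : Module.Projective R F)
      (f : F →ₗ[R] B), Function.Surjective f :=
  ⟨B →₀ R, inferInstance, inferInstance, inferInstance, Finsupp.linearCombination R id,
    Finsupp.linearCombination_id_surjective R B⟩

lemma TOne.of_proj [Module.Projective R F] (f : F →ₗ[R] C) (hf : Function.Surjective f)
    (h : Function.Injective ((LinearMap.ker f).subtype.lTensor M)) : TOne R M C := by
  intro A B _ _ _ _ i p hi hip hp
  obtain ⟨l, hl⟩ := Module.projective_lifting_property p f hp
  have hl' : ∀ y, p (l y) = f y := fun y => LinearMap.congr_fun hl y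
  -- the map `Z → A`
  let e : A ≃ₗ[R] LinearMap.range i := LinearEquiv.ofInjective i hi
  have hz : ∀ z : LinearMap.ker f, l z ∈ LinearMap.range i := fun z => by
    have : p (l z) = 0 := by rw [hl']; exact z.2
    exact (hip _).1 this
  let φ : LinearMap.ker f →ₗ[R] A :=
    e.symm.toLinearMap ∘ₗ LinearMap.codRestrict (LinearMap.range i)
      (l ∘ₗ (LinearMap.ker f).subtype) hz
  have hφ : ∀ z, i (φ z) = l z := fun z => by
    have : e (φ z) = LinearMap.codRestrict (LinearMap.range i)
      (l ∘ₗ (LinearMap.ker f).subtype) hz z := by simp [φ]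
    have h2 := congrArg Subtype.val this
    exact h2
  let α : LinearMap.ker f →ₗ[R] (F × A) := (LinearMap.ker f).subtype.prod (-φ)
  let β : (F × A) →ₗ[R] B := l.coprod i
  have hβ : Function.Surjective β := by
    intro b
    obtain ⟨y, hy⟩ := hf (p b)
    have : p (b - l y) = 0 := by rw [map_sub, hl', hy, sub_self]
    obtain ⟨a, ha⟩ := (hip _).1 this
    exact ⟨(y, a), by simp [β, ha]⟩
  have hαβ : Function.Exact α β := by
    rintro ⟨y, a⟩
    constructor
    · intro h0
      have h0' : l y + i a = 0 := by simpa [β] using h0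
      have hy : f y = 0 := by
        have := congrArg p h0'
        rw [map_add, hl', (hip (i a)).2 ⟨a, rfl⟩, add_zero, map_zero] at this
        exact this
      refine ⟨⟨y, hy⟩, ?_⟩
      refine Prod.ext rfl ?_
      apply hi
      have := hφ ⟨y, hy⟩
      change i (-φ ⟨y, hy⟩) = i a
      rw [map_neg, this]
      exact (eq_neg_of_add_eq_zero_right h0').symm
    · rintro ⟨z, hz'⟩
      rw [← hz']
      simp [α, β, hφ]
  have hex := lTensor_exact M hαβ hβ
  rw [injective_iff_map_eq_zero]
  intro u hu
  have h1 : (β.lTensor M) ((LinearMap.inr R F A).lTensor M u) = 0 := by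
    rw [← LinearMap.comp_apply, ← LinearMap.lTensor_comp]
    simpa [β] using hu
  obtain ⟨w, hw⟩ := (hex _).1 h1
  have h2 : (LinearMap.ker f).subtype.lTensor M w = 0 := by
    have := congrArg ((LinearMap.fst R F A).lTensor M) hw
    rw [← LinearMap.comp_apply, ← LinearMap.lTensor_comp, ← LinearMap.comp_apply,
      ← LinearMap.lTensor_comp] at this
    simpa [α] using this
  have h3 : w = 0 := h (by rw [h2, map_zero])
  have := congrArg ((LinearMap.snd R F A).lTensor M) hw
  rw [h3, map_zero, map_zero, ← LinearMap.comp_apply, ← LinearMap.lTensor_comp] at this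
  simpa using this.symm

lemma TOne.ker (h : TOne R M C) (f : B →ₗ[R] C) (hf : Function.Surjective f) :
    Function.Injective ((LinearMap.ker f).subtype.lTensor M) :=
  h _ _ _ f (LinearMap.ker f).subtype_injective f.exact_subtype_ker_map hf

/-- data for `0 → A → B → C → 0` and `F → B`: the sequence `0 → ker f → ker (p f) → A → 0`. -/
lemma exists_ker_seq (i : A →ₗ[R] B) (p : B →ₗ[R] C) (hi : Function.Injective i)
    (hip : Function.Exact i p) (f : F →ₗ[R] B) (hf : Function.Surjective f) :
    ∃ (j : LinearMap.ker f →ₗ[R] LinearMap.ker (p ∘ₗ f)) (π : LinearMap.ker (p ∘ₗ f) →ₗ[R] A),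
      Function.Injective j ∧ Function.Exact j π ∧ Function.Surjective π ∧
      (LinearMap.ker (p ∘ₗ f)).subtype ∘ₗ j = (LinearMap.ker f).subtype ∧
      i ∘ₗ π = f ∘ₗ (LinearMap.ker (p ∘ₗ f)).subtype := by
  have hle : LinearMap.ker f ≤ LinearMap.ker (p ∘ₗ f) := fun y hy => by
    have : f y = 0 := hy
    simp [this]
  let e : A ≃ₗ[R] LinearMap.range i := LinearEquiv.ofInjective i hi
  have hz : ∀ z : LinearMap.ker (p ∘ₗ f), f z ∈ LinearMap.range i := fun z => (hip _).1 z.2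
  let φ : LinearMap.ker (p ∘ₗ f) →ₗ[R] A :=
    e.symm.toLinearMap ∘ₗ LinearMap.codRestrict (LinearMap.range i)
      (f ∘ₗ (LinearMap.ker (p ∘ₗ f)).subtype) hz
  have hφ : ∀ z, i (φ z) = f z := fun z => by
    have : e (φ z) = LinearMap.codRestrict (LinearMap.range i)
      (f ∘ₗ (LinearMap.ker (p ∘ₗ f)).subtype) hz z := by simp [φ]
    have h2 := congrArg Subtype.val this
    exact h2
  refine ⟨Submodule.inclusion hle, φ, Submodule.inclusion_injective hle, ?_, ?_, ?_, ?_⟩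
  · intro z
    constructor
    · intro h
      have : f z = 0 := by rw [← hφ, h, map_zero]
      exact ⟨⟨z, this⟩, rfl⟩
    · rintro ⟨y, rfl⟩
      apply hi
      rw [hφ, map_zero]
      exact y.2
  · intro a
    obtain ⟨y, hy⟩ := hf (i a)
    refine ⟨⟨y, ?_⟩, ?_⟩
    · change p (f y) = 0
      rw [hy]; exact (hip _).2 ⟨a, rfl⟩
    · apply hi
      rw [hφ]; exact hy
  · rfl
  · exact LinearMap.ext hφ

lemma TOne.quot (i : A →ₗ[R] B) (p : B →ₗ[R] C) (hi : Function.Injective i)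
    (hip : Function.Exact i p) (hp : Function.Surjective p) (hB : TOne R M B)
    (hin : Function.Injective (i.lTensor M)) : TOne R M C := by
  obtain ⟨F, _, _, _, f, hf⟩ := exists_proj_cover (R := R) B
  obtain ⟨j, π, hj, hjπ, hπ, h1, h2⟩ := exists_ker_seq i p hi hip f hf
  refine TOne.of_proj (p ∘ₗ f) (hp.comp hf) ?_
  rw [injective_iff_map_eq_zero]
  intro w hw
  have h3 : π.lTensor M w = 0 := by
    apply hin
    rw [← LinearMap.comp_apply, ← LinearMap.lTensor_comp, h2, LinearMap.lTensor_comp,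
      LinearMap.comp_apply, hw, map_zero, map_zero]
  obtain ⟨v, rfl⟩ := (lTensor_exact M hjπ hπ _).1 h3
  rw [← LinearMap.comp_apply, ← LinearMap.lTensor_comp, h1] at hw
  have : v = 0 := hB.ker f hf (by rw [hw, map_zero])
  rw [this, map_zero]

lemma TOne.ext (i : A →ₗ[R] B) (p : B →ₗ[R] C) (hi : Function.Injective i)
    (hip : Function.Exact i p) (hp : Function.Surjective p) (hA : TOne R M A)
    (hC : TOne R M C) : TOne R M B := by
  obtain ⟨F, _, _, _, f, hf⟩ := exists_proj_cover (R := R) B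
  obtain ⟨j, π, hj, hjπ, hπ, h1, h2⟩ := exists_ker_seq i p hi hip f hf
  refine TOne.of_proj f hf ?_
  rw [← h1, LinearMap.lTensor_comp, LinearMap.coe_comp]
  exact (hC.ker (p ∘ₗ f) (hp.comp hf)).comp (hA _ _ j π hj hjπ hπ)

/-- dimension shifting -/
lemma TOne.sub [Module.Projective R F] (q : F →ₗ[R] C) (hq : Function.Surjective q)
    (hZ : TOne R M (LinearMap.ker q))
    (i : A →ₗ[R] B) (p : B →ₗ[R] C) (hi : Function.Injective i)
    (hip : Function.Exact i p) (hp : Function.Surjective p) (hB : TOne R M B) :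
    TOne R M A := by
  obtain ⟨l, hl⟩ := Module.projective_lifting_property p q hp
  have hl' : ∀ y, p (l y) = q y := fun y => LinearMap.congr_fun hl y
  let β : (F × A) →ₗ[R] B := l.coprod i
  have hβ : Function.Surjective β := by
    intro b
    obtain ⟨y, hy⟩ := hq (p b)
    have : p (b - l y) = 0 := by rw [map_sub, hl', hy, sub_self]
    obtain ⟨a, ha⟩ := (hip _).1 this
    exact ⟨(y, a), by simp [β, ha]⟩
  -- `ker β ≃ ker q`
  have hfst : ∀ z : LinearMap.ker β, (z : F × A).1 ∈ LinearMap.ker q := by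
    rintro ⟨⟨y, a⟩, h0⟩
    have h0' : l y + i a = 0 := by simpa [β] using h0
    have := congrArg p h0'
    rw [map_add, hl', (hip (i a)).2 ⟨a, rfl⟩, add_zero, map_zero] at this
    exact this
  let γ : LinearMap.ker β →ₗ[R] LinearMap.ker q :=
    LinearMap.codRestrict _ (LinearMap.fst R F A ∘ₗ (LinearMap.ker β).subtype) hfst
  have hγ : Function.Bijective γ := by
    constructor
    · rw [injective_iff_map_eq_zero]
      rintro ⟨⟨y, a⟩, h0⟩ h
      have h0' : l y + i a = 0 := by simpa [β] using h0
      have hy : y = 0 := congrArg Subtype.val h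
      subst hy
      have ha : a = 0 := hi (by simpa using h0')
      subst ha
      rfl
    · rintro ⟨y, hy⟩
      have : p (- l y) = 0 := by rw [map_neg, hl', hy, neg_zero]
      obtain ⟨a, ha⟩ := (hip _).1 this
      exact ⟨⟨(y, a), by simp [β, ha]⟩, rfl⟩
  let e := LinearEquiv.ofBijective γ hγ
  have hE : TOne R M (F × A) := by
    refine TOne.ext ((LinearMap.ker β).subtype ∘ₗ e.symm.toLinearMap) β
      ((LinearMap.ker β).subtype_injective.comp e.symm.injective) ?_ hβ hZ hB
    intro y
    constructor
    · intro h
      exact ⟨e ⟨y, h⟩, by simp⟩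
    · rintro ⟨z, rfl⟩
      exact (e.symm z).2
  refine TOne.quot (LinearMap.inl R F A) (LinearMap.snd R F A) LinearMap.inl_injective
    .inl_snd LinearMap.snd_surjective hE ?_
  have : Function.LeftInverse ((LinearMap.fst R F A).lTensor M)
      ((LinearMap.inl R F A).lTensor M) := fun u => by
    rw [← LinearMap.comp_apply, ← LinearMap.lTensor_comp]
    simp
  exact this.injective

lemma TOne.self : TOne R M R := by
  refine TOne.of_proj LinearMap.id Function.surjective_id ?_
  rw [LinearMap.ker_id]
  exact Function.injective_of_subsingleton _

/-- exactness of `M ⊗ X₂ → M ⊗ X₁ → M ⊗ X₀` in terms of the image of `d₁` -/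
lemma exact_lTensor_iff (d₂ : A →ₗ[R] B) (d₁ : B →ₗ[R] C) (h : Function.Exact d₂ d₁) :
    Function.Exact (d₂.lTensor M) (d₁.lTensor M) ↔
      Function.Injective ((LinearMap.range d₁).subtype.lTensor M) := by
  have hs := d₁.surjective_rangeRestrict
  have h' : Function.Exact d₂ d₁.rangeRestrict := by
    intro y
    rw [← h y]
    exact ⟨fun hy => congrArg Subtype.val hy, fun hy => Subtype.ext hy⟩
  have hex := lTensor_exact M h' hs
  have hsur := LinearMap.lTensor_surjective M hs
  have hcomp : ∀ y, d₁.lTensor M y =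
      (LinearMap.range d₁).subtype.lTensor M (d₁.rangeRestrict.lTensor M y) := fun y => by
    rw [← LinearMap.comp_apply, ← LinearMap.lTensor_comp]; rfl
  constructor
  · intro hE
    rw [injective_iff_map_eq_zero]
    intro w hw
    obtain ⟨y, rfl⟩ := hsur w
    rw [← hcomp] at hw
    exact (hex y).2 ((hE y).1 hw)
  · intro hI y
    rw [← hex y, hcomp]
    exact ⟨fun hy => hI (by rw [hy, map_zero]), fun hy => by rw [hy, map_zero]⟩

end TOneSec

section TorSec
variable {R : Type} [CommRing R] [IsNoetherianRing R] (M C : ModuleCat.{0} R)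

lemma torZero_succ_iff (P : ProjectiveResolution C) (n : ℕ) :
    TorZero R (n + 1) M C ↔
      Function.Exact ((P.complex.d (n + 2) (n + 1)).hom.lTensor M)
        ((P.complex.d (n + 1) n).hom.lTensor M) := by
  have h1 : TorZero R (n + 1) M C ↔ Limits.IsZero (((Tor (ModuleCat.{0} R) (n + 1)).obj M).obj C) :=
    ModuleCat.isZero_iff_subsingleton.symm
  rw [h1]
  have h2 := (P.isoLeftDerivedObj ((MonoidalCategory.tensoringLeft (ModuleCat.{0} R)).obj M)
    (n + 1)).isZero_iff
  refine h2.trans ?_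
  refine (HomologicalComplex.exactAt_iff_isZero_homology _ _).symm.trans ?_
  rw [HomologicalComplex.exactAt_iff' _ (n + 2) (n + 1) n (by simp) (by simp),
    ShortComplex.ShortExact.moduleCat_exact_iff_function_exact]
  rfl

lemma resolution_exact (P : ProjectiveResolution C) (n : ℕ) :
    Function.Exact (P.complex.d (n + 2) (n + 1)).hom (P.complex.d (n + 1) n).hom :=
  (ShortComplex.ShortExact.moduleCat_exact_iff_function_exact _).1 (P.exact_succ n)

lemma resolution_exact₀ (P : ProjectiveResolution C) :
    ∃ ε : P.complex.X 0 →ₗ[R] C, Function.Surjective ε ∧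
      LinearMap.range (P.complex.d 1 0).hom = LinearMap.ker ε := by
  refine ⟨(P.π.f 0).hom, (ModuleCat.epi_iff_surjective (P.π.f 0)).1 inferInstance, ?_⟩
  have := (ShortComplex.exact_of_g_is_cokernel
    (ShortComplex.mk _ _ P.complex_d_comp_π_f_zero) P.isColimitCokernelCofork)
  exact this.moduleCat_range_eq_ker

lemma torZero_one_of_tOne (h : TOne R M C) : TorZero R 1 M C := by
  let P := projectiveResolution C
  rw [torZero_succ_iff M C P 0, exact_lTensor_iff _ _ (resolution_exact C P 0)]
  obtain ⟨ε, hε, hr⟩ := resolution_exact₀ C P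
  rw [hr]
  exact h.ker ε hε

lemma tOne_of_torZero_two (h : TorZero R 2 M C) :
    ∃ (F : Type) (_ : AddCommGroup F) (_ : Module R F) (_ : Module.Projective R F)
      (q : F →ₗ[R] C), Function.Surjective q ∧ TOne R M (LinearMap.ker q) := by
  let P := projectiveResolution C
  rw [torZero_succ_iff M C P 1, exact_lTensor_iff _ _ (resolution_exact C P 1)] at h
  obtain ⟨ε, hε, hr⟩ := resolution_exact₀ C P
  refine ⟨P.complex.X 0, inferInstance, inferInstance, inferInstance, ε, hε, ?_⟩
  rw [← hr]
  refine TOne.of_proj (P.complex.d 1 0).hom.rangeRestrict (LinearMap.surjective_rangeRestrict _) ?_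
  rw [LinearMap.ker_rangeRestrict, (resolution_exact C P 0).linearMap_ker_eq]
  exact h

end TorSec

open TensorProduct in
lemma subsingleton_of_tensor {R : Type} [CommRing R] [IsLocalRing R]
    {M K : Type} [AddCommGroup M] [Module R M] [Module.Finite R M] [Nontrivial M]
    [AddCommGroup K] [Module R K] [Module.Finite R K] (h : Subsingleton (M ⊗[R] K)) :
    Subsingleton K := by
  by_contra hK
  rw [← IsLocalRing.subsingleton_tensorProduct (R := R), not_subsingleton_iff_nontrivial] at hK
  have hM : ¬ Subsingleton (ResidueField R ⊗[R] M) := by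
    rw [IsLocalRing.subsingleton_tensorProduct (R := R)]
    exact not_subsingleton M
  rw [not_subsingleton_iff_nontrivial] at hM
  let e := TensorProduct.AlgebraTensorModule.distribBaseChange R (ResidueField R) M K
  have h1 : Subsingleton (ResidueField R ⊗[R] (M ⊗[R] K)) := inferInstance
  have h2 := e.symm.toEquiv.subsingleton
  rw [Module.FaithfullyFlat.subsingleton_tensorProduct_iff_right] at h2
  exact not_subsingleton _ h2

open TensorProduct in
open scoped Pointwise in
lemma step_lemma {R : Type} [CommRing R] [IsNoetherianRing R] [IsLocalRing R]
    (M : ModuleCat.{0} R) [Module.Finite R M] [Nontrivial M] (hrig : TorRigid R M)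
    (S : Type) [AddCommGroup S] [Module R S] [Module.Finite R S] (hS : TOne R M S)
    (x : R) (hx : IsSMulRegular (M ⊗[R] S) x) :
    IsSMulRegular S x ∧ TOne R M (QuotSMulTop x S) := by
  let I : Submodule R S := x • ⊤
  let μ : S →ₗ[R] I := LinearMap.codRestrict I (LinearMap.lsmul R S x)
    (fun s => Submodule.smul_mem_pointwise_smul s x ⊤ trivial)
  have hμs : Function.Surjective μ := by
    rintro ⟨s, t, -, rfl⟩
    exact ⟨t, rfl⟩
  have hcomp : ∀ v : M ⊗[R] S, I.subtype.lTensor M (μ.lTensor M v) = x • v := fun v => by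
    rw [← LinearMap.comp_apply, ← LinearMap.lTensor_comp]
    have : I.subtype ∘ₗ μ = x • LinearMap.id := rfl
    rw [this, LinearMap.lTensor_smul]
    simp
  have hinj : Function.Injective (I.subtype.lTensor M) := by
    rw [injective_iff_map_eq_zero]
    intro u hu
    obtain ⟨v, rfl⟩ := LinearMap.lTensor_surjective M hμs u
    rw [hcomp] at hu
    have : v = 0 := hx (hu.trans (smul_zero x).symm)
    rw [this, map_zero]
  have hex : Function.Exact I.subtype I.mkQ := LinearMap.exact_subtype_mkQ I
  have hC : TOne R M (S ⧸ I) :=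
    TOne.quot I.subtype I.mkQ I.subtype_injective hex I.mkQ_surjective hS hinj
  refine ⟨?_, hC⟩
  have ht1 : TorZero R 1 M (ModuleCat.of R (S ⧸ I)) := torZero_one_of_tOne M _ hC
  have ht2 : TorZero R 2 M (ModuleCat.of R (S ⧸ I)) :=
    hrig _ (inferInstanceAs (Module.Finite R (S ⧸ I))) 1 le_rfl ht1 2 one_le_two
  obtain ⟨F, _, _, _, q, hq, hZ⟩ := tOne_of_torZero_two M _ ht2
  have hI : TOne R M I :=
    TOne.sub q hq hZ I.subtype I.mkQ I.subtype_injective hex I.mkQ_surjective hS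
  have hKinj := hI.ker μ hμs
  have hsub : Subsingleton (M ⊗[R] LinearMap.ker μ) := by
    refine subsingleton_of_forall_eq 0 fun w => ?_
    apply hKinj
    rw [map_zero]
    apply hx
    have : μ ∘ₗ (LinearMap.ker μ).subtype = 0 := LinearMap.ext fun z => z.2
    refine (hcomp _).symm.trans (Eq.trans ?_ (smul_zero x).symm)
    have h0 : μ.lTensor M ((LinearMap.ker μ).subtype.lTensor M w) = 0 := by
      rw [← LinearMap.comp_apply, ← LinearMap.lTensor_comp, this, LinearMap.lTensor_zero,
        LinearMap.zero_apply]
    rw [h0, map_zero]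
  have hK : Subsingleton (LinearMap.ker μ) := subsingleton_of_tensor hsub
  intro a b hab
  have hab' : x • a = x • b := hab
  have hmem : a - b ∈ LinearMap.ker μ := by
    apply Subtype.ext
    change x • (a - b) = 0
    rw [smul_sub, hab', sub_self]
  exact sub_eq_zero.1 (congrArg Subtype.val (Subsingleton.elim (⟨a - b, hmem⟩ : LinearMap.ker μ) 0))

open TensorProduct RingTheory.Sequence in
lemma weaklyRegular_of {R : Type} [CommRing R] [IsNoetherianRing R] [IsLocalRing R]
    (M : ModuleCat.{0} R) [Module.Finite R M] [Nontrivial M] (hrig : TorRigid R M)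
    (rs : List R) : ∀ (S : Type) [AddCommGroup S] [Module R S] [Module.Finite R S],
      TOne R M S → IsWeaklyRegular (M ⊗[R] S) rs → IsWeaklyRegular S rs := by
  induction rs with
  | nil => intro S _ _ _ _ _; exact IsWeaklyRegular.nil R S
  | cons x rs ih =>
    intro S _ _ _ hS h
    rw [isWeaklyRegular_cons_iff] at h ⊢
    obtain ⟨h1, h2⟩ := step_lemma M hrig S hS x h.1
    exact ⟨h1, ih _ h2
      (((QuotSMulTop.tensorQuotSMulTopEquivQuotSMulTop x M S).isWeaklyRegular_congr rs).2 h.2)⟩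

/-- Auslander's depth inequality for Tor-rigid modules. -/
theorem auslander_depth_inequality
    (R : Type) [CommRing R] [IsNoetherianRing R] [IsLocalRing R]
    (M : ModuleCat.{0} R) [Module.Finite R M] [Nontrivial M]
    (𝔞 : Ideal R) (hrig : TorRigid R M) :
    edepth R 𝔞 M ≤ edepth R 𝔞 R := by
  by_cases hR : 𝔞 • (⊤ : Submodule R R) = ⊤
  · simp only [edepth]
    rw [if_pos hR]
    exact le_top
  have hne : 𝔞 ≠ ⊤ := by
    rintro rfl
    exact hR (by simp)
  have hle : 𝔞 ≤ maximalIdeal R := le_maximalIdeal hne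
  have hM : ¬ 𝔞 • (⊤ : Submodule R M) = ⊤ := fun h =>
    Submodule.top_ne_ideal_smul_of_le_jacobson_annihilator
      (hle.trans (maximalIdeal_le_jacobson _)) h.symm
  simp only [edepth]
  rw [if_neg hR, if_neg hM]
  refine sSup_le_sSup ?_
  rintro n ⟨rs, hn, hrs, hreg⟩
  refine ⟨rs, hn, hrs, ?_⟩
  refine RingTheory.Sequence.IsRegular.of_isWeaklyRegular_of_mem_maximalIdeal R
    (fun r hr => hle (hrs r hr)) ?_
  exact weaklyRegular_of M hrig rs R TOne.self
    (((TensorProduct.rid R M).isWeaklyRegular_congr rs).2 hreg.toIsWeaklyRegular)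
end

section
/- Let R be a commutative Noetherian local ring, N a nonzero finitely generated R-module, n ≥ 1, M = Ω_R^n N, and x₁,…,x_n an R-regular sequence with (x₁,…,x_n) · Ext_R^1(N, Ω_R N) = 0. Then there is a short exact sequence 0 → F → ⊕_{i=0}^{n} (Ω_R^{i+n-1} N)^{⊕ C(n,i)} → Ω_R^{n-1}(M/(x₁,…,x_n)M) → 0 where F is free and C(n,i) are binomial coefficients. -/
open CategoryTheory IsLocalRing

namespace SyzAux
section extpart

theorem sc_aux {R : Type} [CommRing R] (x : R) (S : ShortComplex (ModuleCat.{0} R))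
    (h : ∀ e : S.homology, x • e = 0) (z : S.X₂) (hz : S.g.hom z = 0) :
    ∃ y, S.f.hom y = x • z := by
  have h2 : ∀ e : S.moduleCatLeftHomologyData.H, x • e = 0 := by
    intro e
    have h3 := congrArg S.moduleCatHomologyIso.hom.hom (h (S.moduleCatHomologyIso.inv.hom e))
    rw [LinearMap.map_smul, LinearMap.map_zero] at h3
    have : S.moduleCatHomologyIso.hom.hom (S.moduleCatHomologyIso.inv.hom e) = e := by
      rw [← ModuleCat.comp_apply]; simp
    rwa [this] at h3
  let zz : S.moduleCatLeftHomologyData.K := (⟨z, hz⟩ : LinearMap.ker S.g.hom)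
  have h4 := h2 (S.moduleCatLeftHomologyData.π.hom zz)
  rw [← LinearMap.map_smul] at h4
  have h5 := (Submodule.Quotient.mk_eq_zero _).1 h4
  obtain ⟨y, hy⟩ := h5
  exact ⟨y, congrArg Subtype.val hy⟩

theorem ext_aux {R : Type} [CommRing R] (x : R) (N Y : ModuleCat.{0} R)
    (h : SMulExtZero R x 1 N Y) (P : ProjectiveResolution N) (φ : P.complex.X 1 ⟶ Y)
    (hφ : P.complex.d 2 1 ≫ φ = 0) :
    ∃ ψ : P.complex.X 0 ⟶ Y, P.complex.d 1 0 ≫ ψ = x • φ := by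
  let K := P.complex.linearYonedaObj R Y
  have key : ∀ e : (K.sc' 0 1 2).homology, x • e = 0 := by
    intro e
    let I : ((Ext R (ModuleCat.{0} R) 1).obj (Opposite.op N)).obj Y ≅ (K.sc' 0 1 2).homology :=
      P.isoExt (R := R) 1 Y ≪≫ ShortComplex.homologyMapIso (K.isoSc' 0 1 2 (by simp) (by simp))
    have h3 := congrArg I.hom.hom (h (I.inv.hom e))
    rw [LinearMap.map_smul, LinearMap.map_zero] at h3
    have : I.hom.hom (I.inv.hom e) = e := by
      rw [← ModuleCat.comp_apply]; simp
    rwa [this] at h3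
  obtain ⟨y, hy⟩ := sc_aux x _ key φ hφ
  exact ⟨y, hy⟩

theorem lift_of_ext {R : Type} [CommRing R] (x : R) (N Y : ModuleCat.{0} R)
    (h : SMulExtZero R x 1 N Y) {q : ℕ} (g : (Fin q → R) →ₗ[R] N) (hg : Function.Surjective g)
    (e : Y ≃ₗ[R] LinearMap.ker g) : ∃ s : N →ₗ[R] (Fin q → R), ∀ a, g (s a) = x • a := by
  let P := ProjectiveResolution.of N
  let ε : P.complex.X 0 ⟶ N := P.π.f 0
  have hε : Function.Surjective ε.hom := (ModuleCat.epi_iff_surjective _).1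
    (show Epi (P.π.f 0) from inferInstance)
  have hproj : Module.Projective R (P.complex.X 0) :=
    (IsProjective.iff_projective _).2 (P.projective 0)
  obtain ⟨α, hα⟩ := Module.projective_lifting_property g ε.hom hg
  have hα' : ∀ v, g (α v) = ε.hom v := fun v => by rw [← hα]; rfl
  have hd : ∀ v, ε.hom ((P.complex.d 1 0).hom v) = 0 := by
    intro v
    have := P.complex_d_comp_π_f_zero
    exact congrArg (fun f => f.hom v) this
  let φ₀ : P.complex.X 1 →ₗ[R] LinearMap.ker g :=
    LinearMap.codRestrict _ (α ∘ₗ (P.complex.d 1 0).hom) (fun v => by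
      simp [hα', hd])
  let φ : P.complex.X 1 ⟶ Y := ModuleCat.ofHom (e.symm.toLinearMap ∘ₗ φ₀)
  have hφ : P.complex.d 2 1 ≫ φ = 0 := by
    ext v
    have : (P.complex.d 1 0).hom ((P.complex.d 2 1).hom v) = 0 :=
      congrArg (fun f => f.hom v) (P.complex.d_comp_d 2 1 0)
    change e.symm (φ₀ ((P.complex.d 2 1).hom v)) = 0
    rw [LinearEquiv.map_eq_zero_iff]
    ext1
    change α ((P.complex.d 1 0).hom ((P.complex.d 2 1).hom v)) = 0
    rw [this, map_zero]
  obtain ⟨ψ, hψ⟩ := ext_aux x N Y h P φ hφ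
  let θ : P.complex.X 0 →ₗ[R] (Fin q → R) :=
    x • α - (LinearMap.ker g).subtype ∘ₗ e.toLinearMap ∘ₗ ψ.hom
  have hex : LinearMap.range (P.complex.d 1 0).hom = LinearMap.ker ε.hom :=
    P.exact₀.moduleCat_range_eq_ker
  have hθ : LinearMap.ker ε.hom ≤ LinearMap.ker θ := by
    rw [← hex]
    rintro _ ⟨v, rfl⟩
    have h1 : ψ.hom ((P.complex.d 1 0).hom v) = x • e.symm (φ₀ v) :=
      congrArg (fun f => f.hom v) hψ
    rw [LinearMap.mem_ker]
    change x • α ((P.complex.d 1 0).hom v) - ((e (ψ.hom ((P.complex.d 1 0).hom v)) : LinearMap.ker g) : Fin q → R) = 0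
    rw [h1, map_smul, LinearEquiv.apply_symm_apply]
    exact sub_self _
  let s := (LinearMap.ker ε.hom).liftQ θ hθ ∘ₗ (ε.hom.quotKerEquivOfSurjective hε).symm.toLinearMap
  refine ⟨s, fun a => ?_⟩
  obtain ⟨v, rfl⟩ := hε a
  have : s (ε.hom v) = θ v := by
    have h2 : (ε.hom.quotKerEquivOfSurjective hε).symm (ε.hom v) = Submodule.Quotient.mk v := by
      rw [LinearEquiv.symm_apply_eq]; rfl
    change (LinearMap.ker ε.hom).liftQ θ hθ ((ε.hom.quotKerEquivOfSurjective hε).symm (ε.hom v)) = _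
    rw [h2]; rfl
  rw [this]
  change g (x • α v - ((e (ψ.hom v) : LinearMap.ker g) : Fin q → R)) = _
  rw [map_sub, map_smul, hα', (e (ψ.hom v)).2, sub_zero]

end extpart
end SyzAux

namespace SyzAux
open RingTheory.Sequence

section basic
variable {R : Type} [CommRing R] [IsLocalRing R]
variable {A B C : Type} [AddCommGroup A] [Module R A] [AddCommGroup B] [Module R B]
  [AddCommGroup C] [Module R C]

variable (R) in
/-- unbundled form of `IsSyzygyOf` -/
def Syz (N K : Type) [AddCommGroup N] [Module R N] [AddCommGroup K] [Module R K] : Prop :=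
  ∃ (q : ℕ) (g : (Fin q → R) →ₗ[R] N), Function.Surjective g ∧
    (LinearMap.ker g : Submodule R (Fin q → R)) ≤ (maximalIdeal R) • ⊤ ∧
    Nonempty (K ≃ₗ[R] LinearMap.ker g)

theorem syz_iff (N K : ModuleCat.{0} R) : IsSyzygyOf R N K ↔ Syz R N K := Iff.rfl

theorem map_mm (f : A →ₗ[R] B) {v : A} (hv : v ∈ maximalIdeal R • (⊤ : Submodule R A)) :
    f v ∈ maximalIdeal R • (⊤ : Submodule R B) := by
  have : f v ∈ (maximalIdeal R • (⊤ : Submodule R A)).map f := ⟨v, hv, rfl⟩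
  rw [Submodule.map_smul''] at this
  exact Submodule.smul_mono le_rfl le_top this

theorem lift_mm (f : A →ₗ[R] B) (hf : Function.Surjective f) {w : B}
    (hw : w ∈ maximalIdeal R • (⊤ : Submodule R B)) :
    ∃ v ∈ maximalIdeal R • (⊤ : Submodule R A), f v = w := by
  have : (maximalIdeal R • (⊤ : Submodule R A)).map f = maximalIdeal R • (⊤ : Submodule R B) := by
    rw [Submodule.map_smul'', Submodule.map_top, LinearMap.range_eq_top.2 hf]
  rw [← this] at hw
  exact hw

theorem prod_mm {v : A × B} (h1 : v.1 ∈ maximalIdeal R • (⊤ : Submodule R A))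
    (h2 : v.2 ∈ maximalIdeal R • (⊤ : Submodule R B)) :
    v ∈ maximalIdeal R • (⊤ : Submodule R (A × B)) := by
  have e : v = LinearMap.inl R A B v.1 + LinearMap.inr R A B v.2 := by simp
  rw [e]
  exact Submodule.add_mem _ (map_mm _ h1) (map_mm _ h2)

theorem smul_mm {x : R} (hx : x ∈ maximalIdeal R) (a : A) :
    x • a ∈ maximalIdeal R • (⊤ : Submodule R A) :=
  Submodule.smul_mem_smul hx trivial

theorem syz_congr {N N' K K' : Type} [AddCommGroup N] [Module R N] [AddCommGroup K] [Module R K]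
    [AddCommGroup N'] [Module R N'] [AddCommGroup K'] [Module R K']
    (e : N ≃ₗ[R] N') (e' : K ≃ₗ[R] K') (h : Syz R N K) : Syz R N' K' := by
  obtain ⟨q, g, hg, hm, ⟨i⟩⟩ := h
  refine ⟨q, e.toLinearMap ∘ₗ g, e.surjective.comp hg, ?_, ?_⟩
  · rwa [LinearEquiv.ker_comp]
  · rw [LinearEquiv.ker_comp]
    exact ⟨e'.symm.trans i⟩

/-- a syzygy from an arbitrary finite free cover -/
theorem syz_of_free {P N K : Type} [AddCommGroup P] [Module R P] [AddCommGroup N] [Module R N]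
    [AddCommGroup K] [Module R K] [Module.Finite R P] [Module.Free R P] (g : P →ₗ[R] N)
    (hg : Function.Surjective g) (hm : ∀ v, g v = 0 → v ∈ maximalIdeal R • (⊤ : Submodule R P))
    (e : K ≃ₗ[R] LinearMap.ker g) : Syz R N K := by
  let b := Module.finBasis R P
  let f : (Fin (Module.finrank R P) → R) ≃ₗ[R] P := b.equivFun.symm
  refine ⟨_, g ∘ₗ f.toLinearMap, hg.comp f.surjective, ?_, ⟨e.trans (?_ : LinearMap.ker g ≃ₗ[R] LinearMap.ker (g ∘ₗ f.toLinearMap))⟩⟩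
  · intro v hv
    have := map_mm f.symm.toLinearMap (hm (f v) hv)
    simpa using this
  · refine (LinearEquiv.ofSubmodules f _ _ ?_).symm
    ext y
    simp only [Submodule.mem_map, LinearMap.mem_ker]
    constructor
    · rintro ⟨v, hv, rfl⟩; exact hv
    · intro hy; exact ⟨f.symm y, by simpa using hy, by simp⟩

theorem syz_exists [IsNoetherianRing R] (N : Type) [AddCommGroup N] [Module R N] [Module.Finite R N] :
    ∃ (q : ℕ) (g : (Fin q → R) →ₗ[R] N), Function.Surjective g ∧
    (LinearMap.ker g : Submodule R (Fin q → R)) ≤ (maximalIdeal R) • ⊤ := by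
  have hex : ∃ (q : ℕ) (a : Fin q → N), Submodule.span R (Set.range a) = ⊤ :=
    Module.Finite.exists_fin
  classical
  obtain ⟨a, ha⟩ := Nat.find_spec hex
  have hmin := fun m => Nat.find_min (m := m) hex
  generalize Nat.find hex = q at a ha hmin
  refine ⟨q, Fintype.linearCombination R a, ?_, ?_⟩
  · rw [← LinearMap.range_eq_top, Fintype.range_linearCombination, ha]
  intro v hv
  have hall : ∀ i, v i ∈ maximalIdeal R := by
    intro i
    by_contra hi
    have hu : IsUnit (v i) := by simpa using hi
    obtain ⟨q, rfl⟩ : ∃ q', q = q' + 1 := ⟨q - 1, by have := i.2; omega⟩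
    refine hmin q (by omega) ⟨fun j => a (i.succAbove j), ?_⟩
    set S := Submodule.span R (Set.range fun j => a (i.succAbove j))
    have hS : ∀ j, a (i.succAbove j) ∈ S := fun j => Submodule.subset_span ⟨j, rfl⟩
    have hai : a i ∈ S := by
      rw [LinearMap.mem_ker, Fintype.linearCombination_apply, Fin.sum_univ_succAbove _ i] at hv
      rw [← Submodule.smul_mem_iff_of_isUnit S hu, eq_neg_of_add_eq_zero_left hv]
      exact S.neg_mem (S.sum_mem fun j _ => S.smul_mem _ (hS j))
    rw [← top_le_iff, ← ha, Submodule.span_le]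
    rintro _ ⟨k, rfl⟩
    rcases Fin.eq_self_or_eq_succAbove i k with rfl | ⟨j, rfl⟩
    · exact hai
    · exact hS j
  rw [pi_eq_sum_univ' v]
  exact Submodule.sum_mem _ fun i _ => smul_mm (hall i) _

theorem surj_of_min {P N : Type} [AddCommGroup P] [Module R P] [AddCommGroup N] [Module R N]
    [Module.Finite R P] (g : P →ₗ[R] N)
    (hm : LinearMap.ker g ≤ maximalIdeal R • (⊤ : Submodule R P))
    (h : A →ₗ[R] P) (hs : Function.Surjective (g ∘ₗ h)) : Function.Surjective h := by
  rw [← LinearMap.range_eq_top, ← top_le_iff]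
  refine Submodule.le_of_le_smul_of_le_jacobson_bot Module.Finite.fg_top
    (IsLocalRing.maximalIdeal_le_jacobson _) ?_
  intro v _
  obtain ⟨a, ha⟩ := hs (g v)
  have : v = h a + (v - h a) := by abel
  rw [this]
  refine Submodule.add_mem_sup ⟨a, rfl⟩ (hm ?_)
  simp only [LinearMap.comp_apply] at ha
  simp [ha]

theorem syz_unique {N K K' : Type} [AddCommGroup N] [Module R N] [AddCommGroup K] [Module R K]
    [AddCommGroup K'] [Module R K'] (h : Syz R N K) (h' : Syz R N K') : Nonempty (K ≃ₗ[R] K') := by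
  obtain ⟨q, g, hg, hm, ⟨i⟩⟩ := h
  obtain ⟨q', g', hg', hm', ⟨i'⟩⟩ := h'
  obtain ⟨f, hf⟩ := Module.projective_lifting_property g' g hg'
  obtain ⟨f', hf'⟩ := Module.projective_lifting_property g g' hg
  have sf : Function.Surjective f := surj_of_min g' hm' f (by rw [hf]; exact hg)
  have sf' : Function.Surjective f' := surj_of_min g hm f' (by rw [hf']; exact hg')
  have inj : Function.Injective (f' ∘ₗ f) :=
    OrzechProperty.injective_of_surjective_endomorphism _ (sf'.comp sf)
  have injf : Function.Injective f := by
    rw [LinearMap.coe_comp] at inj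
    exact inj.of_comp
  let e := LinearEquiv.ofBijective f ⟨injf, sf⟩
  refine ⟨(i.trans (LinearEquiv.ofSubmodules e _ _ ?_)).trans i'.symm⟩
  ext y
  simp only [Submodule.mem_map, LinearMap.mem_ker]
  constructor
  · rintro ⟨v, hv, rfl⟩
    rw [← hf] at hv; exact hv
  · intro hy
    obtain ⟨v, rfl⟩ := sf y
    exact ⟨v, by rw [← hf]; exact hy, rfl⟩

theorem syz_finite [IsNoetherianRing R] {N K : Type} [AddCommGroup N] [Module R N] [AddCommGroup K]
    [Module R K] (h : Syz R N K) : Module.Finite R K := by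
  obtain ⟨q, g, hg, hm, ⟨i⟩⟩ := h
  exact Module.Finite.equiv i.symm

theorem syz_prod {N K N' K' : Type} [AddCommGroup N] [Module R N] [AddCommGroup K] [Module R K]
    [AddCommGroup N'] [Module R N'] [AddCommGroup K'] [Module R K']
    (h : Syz R N K) (h' : Syz R N' K') : Syz R (N × N') (K × K') := by
  obtain ⟨q, g, hg, hm, ⟨i⟩⟩ := h
  obtain ⟨q', g', hg', hm', ⟨i'⟩⟩ := h'
  refine syz_of_free (g.prodMap g') (hg.prodMap hg') ?_ ?_
  · intro v hv
    rw [Prod.ext_iff] at hv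
    exact prod_mm (hm hv.1) (hm' hv.2)
  · refine (i.prodCongr i').trans (?_ : _ ≃ₗ[R] LinearMap.ker (g.prodMap g'))
    exact LinearEquiv.ofLinearMap
      (LinearMap.codRestrict _ ((LinearMap.ker g).subtype.prodMap (LinearMap.ker g').subtype)
        (fun v => by rcases v with ⟨⟨a, ha⟩, ⟨b, hb⟩⟩; simpa using ⟨ha, hb⟩))
      (LinearMap.prod
        (LinearMap.codRestrict _ (LinearMap.fst R _ _ ∘ₗ Submodule.subtype _)
          (fun v => by have := v.2; rw [LinearMap.mem_ker, Prod.ext_iff] at this; exact this.1))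
        (LinearMap.codRestrict _ (LinearMap.snd R _ _ ∘ₗ Submodule.subtype _)
          (fun v => by have := v.2; rw [LinearMap.mem_ker, Prod.ext_iff] at this; exact this.2)))
      (by ext <;> rfl) (by ext <;> rfl)

end basic

section nth
variable {R : Type} [CommRing R] [IsLocalRing R]

theorem nth_congr (n : ℕ) : ∀ {N N' K K' : ModuleCat.{0} R} (_ : N ≃ₗ[R] N') (_ : K ≃ₗ[R] K')
    (_ : IsNthSyzygyOf R n N K), IsNthSyzygyOf R n N' K' := by
  induction n with
  | zero => rintro N N' K K' e e' ⟨i⟩; exact ⟨e'.symm.trans (i.trans e)⟩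
  | succ n ih =>
    rintro N N' K K' e e' ⟨L, hL, h⟩
    exact ⟨L, syz_congr e (LinearEquiv.refl R L) hL, ih (LinearEquiv.refl R L) e' h⟩

theorem nth_unique (n : ℕ) : ∀ {N K K' : ModuleCat.{0} R}
    (_ : IsNthSyzygyOf R n N K) (_ : IsNthSyzygyOf R n N K'), Nonempty (K ≃ₗ[R] K') := by
  induction n with
  | zero => rintro N K K' ⟨i⟩ ⟨i'⟩; exact ⟨i.trans i'.symm⟩
  | succ n ih =>
    rintro N K K' ⟨L, hL, h⟩ ⟨L', hL', h'⟩
    obtain ⟨e⟩ := syz_unique hL hL'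
    exact ih (nth_congr n e (LinearEquiv.refl R K) h) h'

theorem nth_snoc (n : ℕ) : ∀ {N B K : ModuleCat.{0} R}
    (_ : IsNthSyzygyOf R n N B) (_ : IsSyzygyOf R B K), IsNthSyzygyOf R (n+1) N K := by
  induction n with
  | zero =>
    rintro N B K ⟨i⟩ h
    exact ⟨K, syz_congr i (LinearEquiv.refl R K) h, ⟨LinearEquiv.refl R K⟩⟩
  | succ n ih =>
    rintro N B K ⟨L, hL, h⟩ h'
    exact ⟨L, hL, ih h h'⟩

theorem nth_unsnoc (n : ℕ) : ∀ {N K : ModuleCat.{0} R}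
    (_ : IsNthSyzygyOf R (n+1) N K), ∃ B : ModuleCat.{0} R, IsNthSyzygyOf R n N B ∧
      IsSyzygyOf R B K := by
  induction n with
  | zero =>
    rintro N K ⟨L, hL, ⟨i⟩⟩
    exact ⟨N, ⟨LinearEquiv.refl R N⟩, syz_congr (LinearEquiv.refl R N) i.symm hL⟩
  | succ n ih =>
    rintro N K ⟨L, hL, h⟩
    obtain ⟨B, h1, h2⟩ := ih h
    exact ⟨B, ⟨L, hL, h1⟩, h2⟩

theorem nth_finite [IsNoetherianRing R] (n : ℕ) : ∀ {N K : ModuleCat.{0} R}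
    (_ : Module.Finite R N) (_ : IsNthSyzygyOf R n N K), Module.Finite R K := by
  induction n with
  | zero => rintro N K hN ⟨i⟩; exact Module.Finite.equiv i.symm
  | succ n ih =>
    rintro N K hN ⟨L, hL, h⟩
    exact ih (syz_finite hL) h

end nth

section factor
variable {R : Type} [CommRing R]

/-- multiplication by `x` on `L` factors through a finite free module -/
def Fact' (x : R) (L : Type) [AddCommGroup L] [Module R L] : Prop :=
  ∃ (q : ℕ) (a : L →ₗ[R] (Fin q → R)) (b : (Fin q → R) →ₗ[R] L), ∀ v, b (a v) = x • v

variable {x : R} {L L' K Q : Type} [AddCommGroup L] [Module R L] [AddCommGroup L'] [Module R L']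
  [AddCommGroup K] [Module R K] [AddCommGroup Q] [Module R Q]

theorem fact_lift (h : Fact' x L) {P : Type} [AddCommGroup P] [Module R P] (g : P →ₗ[R] Q)
    (hg : Function.Surjective g) (p : L →ₗ[R] Q) : ∃ t : L →ₗ[R] P, ∀ v, g (t v) = x • p v := by
  obtain ⟨q, a, b, hab⟩ := h
  obtain ⟨f, hf⟩ := Module.projective_lifting_property g (p ∘ₗ b) hg
  refine ⟨f ∘ₗ a, fun v => ?_⟩
  have : g (f (a v)) = p (b (a v)) := LinearMap.congr_fun hf (a v)
  simp [this, hab]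

theorem fact_congr (e : L ≃ₗ[R] L') (h : Fact' x L) : Fact' x L' := by
  obtain ⟨q, a, b, hab⟩ := h
  exact ⟨q, a ∘ₗ e.symm.toLinearMap, e.toLinearMap ∘ₗ b, fun v => by simp [hab]⟩

theorem fact_prod (h : Fact' x L) (h' : Fact' x L') : Fact' x (L × L') := by
  obtain ⟨q, a, b, hab⟩ := h
  obtain ⟨q', a', b', hab'⟩ := h'
  let e : ((Fin q → R) × (Fin q' → R)) ≃ₗ[R] (Fin (q + q') → R) :=
    (LinearEquiv.sumArrowLequivProdArrow (Fin q) (Fin q') R R).symm.trans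
      (LinearEquiv.funCongrLeft R R finSumFinEquiv.symm)
  exact ⟨q + q', e.toLinearMap ∘ₗ a.prodMap a', b.prodMap b' ∘ₗ e.symm.toLinearMap,
    fun v => by simp [hab, hab', Prod.ext_iff]⟩

theorem fact_ker (h : Fact' x L) {q : ℕ} (g : (Fin q → R) →ₗ[R] L) (hg : Function.Surjective g) :
    Fact' x (LinearMap.ker g) := by
  obtain ⟨s, hs⟩ := fact_lift h g hg LinearMap.id
  refine ⟨q, (LinearMap.ker g).subtype, LinearMap.codRestrict _ (x • LinearMap.id - s ∘ₗ g) ?_, ?_⟩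
  · intro v; simp [hs]
  · rintro ⟨v, hv⟩
    ext1
    rw [LinearMap.mem_ker] at hv
    simp [hv]

end factor

section pres
variable {R : Type} [CommRing R] [IsLocalRing R]

variable (R) in
/-- `Q` is `G` modulo a finite free module, minimally embedded. -/
def Pres (G Q : Type) [AddCommGroup G] [Module R G] [AddCommGroup Q] [Module R Q] : Prop :=
  ∃ (r : ℕ) (i : (Fin r → R) →ₗ[R] G) (p : G →ₗ[R] Q), Function.Injective i ∧
    Function.Surjective p ∧ LinearMap.range i = LinearMap.ker p ∧
    ∀ v, i v ∈ maximalIdeal R • (⊤ : Submodule R G) →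
      v ∈ maximalIdeal R • (⊤ : Submodule R (Fin r → R))

/-- pullback of `g : P → Q` along multiplication by `x` -/
def pb (x : R) {P Q : Type} [AddCommGroup P] [Module R P] [AddCommGroup Q] [Module R Q]
    (g : P →ₗ[R] Q) : Submodule R (P × Q) :=
  LinearMap.ker (g ∘ₗ LinearMap.fst R P Q - x • LinearMap.snd R P Q)

theorem mem_pb {x : R} {P Q : Type} [AddCommGroup P] [Module R P] [AddCommGroup Q] [Module R Q]
    {g : P →ₗ[R] Q} {v : P × Q} : v ∈ pb x g ↔ g v.1 = x • v.2 := by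
  simp [pb, sub_eq_zero]

variable (R) in
/-- `E` is the pullback of a minimal cover of `Q` along `x` -/
def IsE (x : R) (Q E : Type) [AddCommGroup Q] [Module R Q] [AddCommGroup E] [Module R E] : Prop :=
  ∃ (q : ℕ) (g : (Fin q → R) →ₗ[R] Q), Function.Surjective g ∧
    (LinearMap.ker g : Submodule R (Fin q → R)) ≤ (maximalIdeal R) • ⊤ ∧
    Nonempty (E ≃ₗ[R] pb x g)

variable {G G' Q Q' K E : Type} [AddCommGroup G] [Module R G] [AddCommGroup G'] [Module R G']
  [AddCommGroup Q] [Module R Q]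
  [AddCommGroup Q'] [Module R Q'] [AddCommGroup K] [Module R K] [AddCommGroup E] [Module R E]

theorem pres_congr (e : G ≃ₗ[R] G') (e' : Q ≃ₗ[R] Q') (h : Pres R G Q) : Pres R G' Q' := by
  obtain ⟨r, i, p, hi, hp, hr, hm⟩ := h
  refine ⟨r, e.toLinearMap ∘ₗ i, e'.toLinearMap ∘ₗ p ∘ₗ e.symm.toLinearMap, e.injective.comp hi,
    e'.surjective.comp (hp.comp e.symm.surjective), ?_, ?_⟩
  · ext y
    rw [LinearEquiv.ker_comp, LinearMap.mem_ker, LinearMap.comp_apply, ← LinearMap.mem_ker, ← hr]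
    simp only [LinearMap.mem_range, LinearMap.comp_apply, LinearEquiv.coe_coe]
    refine exists_congr fun v => ?_
    rw [LinearEquiv.eq_symm_apply]
  · intro v hv
    apply hm
    simpa using map_mm e.symm.toLinearMap hv

/-- a syzygy of `Q` is a syzygy of `G` -/
theorem syz_of_pres (h : Pres R G Q) (hK : Syz R Q K) : Syz R G K := by
  obtain ⟨r, i, p, hi, hp, hr, hm⟩ := h
  obtain ⟨q, g, hg, hgm, ⟨e⟩⟩ := hK
  have hpi : ∀ v, p (i v) = 0 := fun v => by
    have : i v ∈ LinearMap.ker p := hr ▸ ⟨v, rfl⟩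
    exact this
  obtain ⟨f, hf⟩ := Module.projective_lifting_property p g hp
  have hf' : ∀ v, p (f v) = g v := fun v => LinearMap.congr_fun hf v
  refine syz_of_free (f.coprod i) ?_ ?_ (e.trans (LinearEquiv.symm
    (?_ : LinearMap.ker (f.coprod i) ≃ₗ[R] LinearMap.ker g)))
  · intro y
    obtain ⟨a, ha⟩ := hg (p y)
    have : y - f a ∈ LinearMap.ker p := by simp [hf', ha]
    rw [← hr] at this
    obtain ⟨b, hb⟩ := this
    exact ⟨(a, b), by simp [hb]⟩
  · rintro ⟨a, b⟩ hv
    simp only [LinearMap.coprod_apply] at hv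
    have ha : g a = 0 := by
      have := congrArg p hv
      simpa [hf', hpi] using this
    have ha' := hgm (show a ∈ LinearMap.ker g from ha)
    refine prod_mm ha' (hm b ?_)
    rw [eq_neg_of_add_eq_zero_right hv]
    exact Submodule.neg_mem _ (map_mm f ha')
  · refine LinearEquiv.ofBijective (LinearMap.codRestrict _
      (LinearMap.fst R _ _ ∘ₗ (LinearMap.ker (f.coprod i)).subtype) ?_) ⟨?_, ?_⟩
    · rintro ⟨⟨a, b⟩, hv⟩
      simp only [LinearMap.mem_ker, LinearMap.coprod_apply] at hv
      have := congrArg p hv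
      simpa [hf', hpi] using this
    · rw [← LinearMap.ker_eq_bot, LinearMap.ker_eq_bot']
      rintro ⟨⟨a, b⟩, hv⟩ h0
      have ha : a = 0 := congrArg Subtype.val h0
      subst ha
      simp only [LinearMap.mem_ker, LinearMap.coprod_apply, map_zero, zero_add] at hv
      have hb : b = 0 := hi (by simpa using hv)
      subst hb
      rfl
    · rintro ⟨a, ha⟩
      have : - f a ∈ LinearMap.ker p := by
        rw [LinearMap.mem_ker] at ha
        simp [hf', ha]
      rw [← hr] at this
      obtain ⟨b, hb⟩ := this
      exact ⟨⟨(a, b), by simp [hb]⟩, rfl⟩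

theorem pres_step {x : R} (h : Pres R G Q) (hF : Fact' x G) (hK : Syz R G K) (hE : IsE R x Q E) :
    Pres R (K × G) E := by
  obtain ⟨q, g, hg, hgm, ⟨e⟩⟩ := hE
  have hK' : Syz R G (LinearMap.ker g) :=
    syz_of_pres h ⟨q, g, hg, hgm, ⟨LinearEquiv.refl R _⟩⟩
  obtain ⟨k⟩ := syz_unique hK hK'
  refine pres_congr (k.symm.prodCongr (LinearEquiv.refl R G)) e.symm ?_
  obtain ⟨r, i, p, hi, hp, hr, hm⟩ := h
  have hpi : ∀ v, p (i v) = 0 := fun v => by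
    have : i v ∈ LinearMap.ker p := hr ▸ ⟨v, rfl⟩
    exact this
  obtain ⟨t, ht⟩ := fact_lift hF g hg p
  refine ⟨r, LinearMap.prod (LinearMap.codRestrict _ (-(t ∘ₗ i)) ?_) i,
    LinearMap.codRestrict _ (LinearMap.prod ((LinearMap.ker g).subtype.coprod t)
      (p ∘ₗ LinearMap.snd R _ _)) ?_, ?_, ?_, ?_, ?_⟩
  · intro v; simp [ht, hpi]
  · rintro ⟨⟨a, ha⟩, b⟩
    rw [LinearMap.mem_ker] at ha
    rw [mem_pb]
    simp [ht, ha]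
  · intro v w hvw
    exact hi (congrArg Prod.snd hvw)
  · rintro ⟨⟨a, b⟩, hab⟩
    rw [mem_pb] at hab
    obtain ⟨c, rfl⟩ := hp b
    refine ⟨(⟨a - t c, ?_⟩, c), ?_⟩
    · simp only at hab
      simp [ht, hab]
    · ext1
      simp
  · ext ⟨⟨a, ha⟩, b⟩
    constructor
    · rintro ⟨v, hv⟩
      rw [← hv, LinearMap.mem_ker]
      ext1
      simp [hpi]
    · intro hv
      rw [LinearMap.mem_ker] at hv
      have hv' := congrArg Subtype.val hv
      have h1 : a + t b = 0 := congrArg Prod.fst hv'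
      have h2 : p b = 0 := congrArg Prod.snd hv'
      have : b ∈ LinearMap.ker p := h2
      rw [← hr] at this
      obtain ⟨v, rfl⟩ := this
      refine ⟨v, ?_⟩
      ext1
      · ext1
        exact (eq_neg_of_add_eq_zero_left h1).symm
      · rfl
  · intro v hv
    exact hm v (map_mm (LinearMap.snd R _ _) hv)

theorem pres_base {x : R} (hF : Fact' x Q) (hK : Syz R Q K) (hx : IsSMulRegular R x)
    (p : K →ₗ[R] Q') (hp : Function.Surjective p) (hpk : ∀ m, p m = 0 ↔ ∃ m', m = x • m') :
    Pres R (K × Q) Q' := by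
  obtain ⟨q, g, hg, hgm, ⟨k⟩⟩ := hK
  obtain ⟨s, hs⟩ := fact_lift hF g hg LinearMap.id
  simp only [LinearMap.id_apply] at hs
  -- the map `v ↦ x v - s g v` into the kernel
  let u : (Fin q → R) →ₗ[R] LinearMap.ker g :=
    LinearMap.codRestrict _ (x • LinearMap.id - s ∘ₗ g) (fun v => by simp [hs])
  have hu : ∀ v : LinearMap.ker g, u v = x • v := by
    rintro ⟨v, hv⟩
    rw [LinearMap.mem_ker] at hv
    ext1
    simp [u, hv]
  let w₀ : (Fin q → R) →ₗ[R] Q' := p ∘ₗ k.symm.toLinearMap ∘ₗ u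
  have hw₀ : LinearMap.ker g ≤ LinearMap.ker w₀ := by
    intro v hv
    have h1 := hu ⟨v, hv⟩
    simp only at h1
    rw [LinearMap.mem_ker]
    change p (k.symm (u v)) = 0
    rw [h1, hpk, map_smul]
    exact ⟨_, rfl⟩
  let w := (LinearMap.ker g).liftQ w₀ hw₀ ∘ₗ (g.quotKerEquivOfSurjective hg).symm.toLinearMap
  have hw : ∀ v, w (g v) = p (k.symm (u v)) := by
    intro v
    have h2 : (g.quotKerEquivOfSurjective hg).symm (g v) = Submodule.Quotient.mk v := by
      rw [LinearEquiv.symm_apply_eq]; rfl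
    change (LinearMap.ker g).liftQ w₀ hw₀ ((g.quotKerEquivOfSurjective hg).symm (g v)) = _
    rw [h2]; rfl
  refine ⟨q, LinearMap.prod (k.symm.toLinearMap ∘ₗ u) g, p.coprod (-w), ?_, ?_, ?_, ?_⟩
  · rw [← LinearMap.ker_eq_bot, LinearMap.ker_eq_bot']
    intro v hv
    rw [Prod.ext_iff] at hv
    obtain ⟨h1, h2⟩ := hv
    have h2' : g v = 0 := h2
    have h1' : k.symm (u v) = 0 := h1
    rw [LinearEquiv.map_eq_zero_iff] at h1'
    have h3 := hu ⟨v, h2'⟩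
    simp only at h3
    rw [h3] at h1'
    have h4 : x • v = 0 := congrArg Subtype.val h1'
    ext j
    have h5 : x • v j = x • (0 : R) := by rw [smul_zero]; exact congrFun h4 j
    exact hx h5
  · intro y
    obtain ⟨a, rfl⟩ := hp y
    exact ⟨(a, 0), by simp⟩
  · ext ⟨a, b⟩
    constructor
    · rintro ⟨v, hv⟩
      rw [← hv, LinearMap.mem_ker]
      simp [hw]
    · intro hab
      obtain ⟨v, rfl⟩ := hg b
      simp only [LinearMap.mem_ker, LinearMap.coprod_apply, LinearMap.neg_apply, hw,
        ← sub_eq_add_neg, ← map_sub] at hab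
      obtain ⟨m, hm⟩ := (hpk _).1 hab
      refine ⟨v + k m, ?_⟩
      have h6 : g (k m : Fin q → R) = 0 := (k m).2
      ext1
      · simp [hu, ← hm]
      · simp [h6]
  · intro v hv
    have h1 : g v ∈ maximalIdeal R • (⊤ : Submodule R Q) := map_mm (LinearMap.snd R _ _) hv
    obtain ⟨v', hv', h2⟩ := lift_mm g hg h1
    have : v = v' + (v - v') := by abel
    rw [this]
    exact Submodule.add_mem _ hv' (hgm (by simp [h2]))

theorem isE_exists [IsNoetherianRing R] (x : R) (Q : Type) [AddCommGroup Q] [Module R Q]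
    [Module.Finite R Q] : ∃ E : ModuleCat.{0} R, IsE R x Q E := by
  obtain ⟨q, g, hg, hm⟩ := syz_exists (R := R) Q
  exact ⟨ModuleCat.of R (pb x g), q, g, hg, hm, ⟨LinearEquiv.refl R _⟩⟩

theorem isE_syz {x : R} (hx : x ∈ maximalIdeal R) (hE : IsE R x Q E) (hreg : IsSMulRegular Q x)
    (p : Q →ₗ[R] Q') (hp : Function.Surjective p) (hpk : ∀ m, p m = 0 ↔ ∃ m', m = x • m') :
    Syz R Q' E := by
  obtain ⟨q, g, hg, hm, ⟨e⟩⟩ := hE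
  refine ⟨q, p ∘ₗ g, hp.comp hg, ?_, ⟨e.trans (?_ : pb x g ≃ₗ[R] LinearMap.ker (p ∘ₗ g))⟩⟩
  · intro v hv
    obtain ⟨m, hm'⟩ := (hpk _).1 hv
    obtain ⟨w, rfl⟩ := hg m
    have : v = x • w + (v - x • w) := by abel
    rw [this]
    refine Submodule.add_mem _ (smul_mm hx w) (hm ?_)
    simp [hm']
  · refine LinearEquiv.ofBijective (LinearMap.codRestrict _
      (LinearMap.fst R _ _ ∘ₗ (pb x g).subtype) ?_) ⟨?_, ?_⟩
    · rintro ⟨v, hv⟩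
      rw [mem_pb] at hv
      exact (hpk _).2 ⟨_, hv⟩
    · rw [← LinearMap.ker_eq_bot, LinearMap.ker_eq_bot']
      rintro ⟨⟨a, b⟩, hv⟩ h0
      have ha : a = 0 := congrArg Subtype.val h0
      subst ha
      rw [mem_pb] at hv
      simp only [map_zero] at hv
      have hb : b = 0 := hreg (by simpa using hv.symm)
      subst hb
      rfl
    · rintro ⟨a, ha⟩
      obtain ⟨b, hb⟩ := (hpk _).1 ha
      exact ⟨⟨(a, b), mem_pb.2 hb⟩, rfl⟩

theorem isE_succ [IsNoetherianRing R] {x : R} (hx : x ∈ maximalIdeal R) (hE : IsE R x Q E) :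
    ∃ K E' : ModuleCat.{0} R, Syz R Q K ∧ IsE R x K E' ∧ Syz R E E' := by
  obtain ⟨q, g, hg, hm, ⟨e⟩⟩ := hE
  obtain ⟨r, f, hf, hm'⟩ := syz_exists (R := R) (LinearMap.ker g)
  refine ⟨ModuleCat.of R (LinearMap.ker g), ModuleCat.of R (pb x f),
    ⟨q, g, hg, hm, ⟨LinearEquiv.refl R _⟩⟩, ⟨r, f, hf, hm', ⟨LinearEquiv.refl R _⟩⟩, ?_⟩
  refine syz_congr e.symm (LinearEquiv.refl R _) ?_
  -- the cover `R^r × R^q → pb x g`, `(a, b) ↦ (x b - f a, g b)`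
  let c : ((Fin r → R) × (Fin q → R)) →ₗ[R] pb x g :=
    LinearMap.codRestrict _ (LinearMap.prod
      ((-((LinearMap.ker g).subtype ∘ₗ f)).coprod (x • LinearMap.id))
      (g ∘ₗ LinearMap.snd R _ _)) (by
        rintro ⟨a, b⟩
        have h6 : g (f a : Fin q → R) = 0 := (f a).2
        rw [mem_pb]
        simp [h6])
  have hc : ∀ a b, c (a, b) = 0 ↔ (f a : Fin q → R) = x • b ∧ g b = 0 := by
    intro a b
    rw [← Subtype.coe_inj]
    simp [c, Prod.ext_iff, neg_add_eq_zero]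
  refine syz_of_free c ?_ ?_ (LinearEquiv.ofBijective (LinearMap.codRestrict _
      (LinearMap.prodMap LinearMap.id (LinearMap.ker g).subtype ∘ₗ (pb x f).subtype) ?_) ⟨?_, ?_⟩)
  · rintro ⟨⟨a, b⟩, hab⟩
    rw [mem_pb] at hab
    simp only at hab
    obtain ⟨b, rfl⟩ := hg b
    obtain ⟨v, hv⟩ := hf ⟨x • b - a, by simp [hab]⟩
    refine ⟨(v, b), ?_⟩
    ext1
    simp [c, hv]
  · rintro ⟨a, b⟩ hv
    rw [hc] at hv
    obtain ⟨h1, h2⟩ := hv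
    refine prod_mm ?_ (hm h2)
    obtain ⟨d, hd⟩ := hf ⟨b, h2⟩
    have : a = x • d + (a - x • d) := by abel
    simp only
    rw [this]
    refine Submodule.add_mem _ (smul_mm hx d) (hm' ?_)
    rw [LinearMap.mem_ker, map_sub, map_smul, hd, sub_eq_zero]
    ext1
    exact h1
  · rintro ⟨⟨a, b⟩, hab⟩
    rw [mem_pb] at hab
    rw [LinearMap.mem_ker]
    exact (hc a b).2 ⟨congrArg Subtype.val hab, b.2⟩
  · rintro ⟨⟨a, b⟩, hab⟩ ⟨⟨a', b'⟩, hab'⟩ h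
    have h' := congrArg Subtype.val h
    simpa [Prod.ext_iff] using h'
  · rintro ⟨⟨a, b⟩, hab⟩
    have := (hc a b).1 hab
    exact ⟨⟨(a, ⟨b, this.2⟩), mem_pb.2 (Subtype.ext this.1)⟩, rfl⟩

theorem isE_nth [IsNoetherianRing R] {x : R} (hx : x ∈ maximalIdeal R) (j : ℕ) :
    ∀ {Q E : ModuleCat.{0} R} (_ : IsE R x Q E),
    ∃ K E' : ModuleCat.{0} R, IsNthSyzygyOf R j Q K ∧ IsE R x K E' ∧ IsNthSyzygyOf R j E E' := by
  induction j with
  | zero => intro Q E h; exact ⟨Q, E, ⟨LinearEquiv.refl R _⟩, h, ⟨LinearEquiv.refl R _⟩⟩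
  | succ j ih =>
    intro Q E h
    obtain ⟨K, E', h1, h2, h3⟩ := isE_succ hx h
    obtain ⟨K', E'', h4, h5, h6⟩ := ih h2
    exact ⟨K', E'', ⟨K, h1, h4⟩, h5, ⟨E', h3, h6⟩⟩

end pres

section reg
variable {R : Type} [CommRing R]

theorem reg_ses (r : R) (rs : List R) : ∀ {A P B : Type} [AddCommGroup A] [Module R A]
    [AddCommGroup P] [Module R P] [AddCommGroup B] [Module R B] (f : A →ₗ[R] P) (g : P →ₗ[R] B)
    (_ : Function.Injective f) (_ : Function.Exact f g) (_ : Function.Surjective g)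
    (_ : IsWeaklyRegular P (rs ++ [r])) (_ : IsWeaklyRegular B rs),
    IsWeaklyRegular A (rs ++ [r]) := by
  induction rs with
  | nil =>
    intro A P B _ _ _ _ _ _ f g hf hfg hg hP hB
    simp only [List.nil_append, isWeaklyRegular_singleton_iff] at *
    exact hP.of_injective f hf
  | cons a t ih =>
    intro A P B _ _ _ _ _ _ f g hf hfg hg hP hB
    simp only [List.cons_append, isWeaklyRegular_cons_iff] at *
    refine ⟨hP.1.of_injective f hf, ih (QuotSMulTop.map a f) (QuotSMulTop.map a g) ?_ ?_ ?_ hP.2 hB.2⟩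
    · have h0 : Function.Exact (0 : PUnit.{1} →ₗ[R] A) f := by
        intro y
        simp only [LinearMap.zero_apply, Set.mem_range, exists_const]
        rw [map_eq_zero_iff f hf, eq_comm]
      have := QuotSMulTop.map_first_exact_on_four_term_exact_of_isSMulRegular_last h0 hfg hB.1
      rw [← LinearMap.ker_eq_bot, this.linearMap_ker_eq, LinearMap.range_eq_bot]
      refine LinearMap.ext fun y => ?_
      obtain ⟨y, rfl⟩ := Submodule.Quotient.mk_surjective _ y
      rw [QuotSMulTop.map_apply_mk]
      simp
    · exact QuotSMulTop.map_exact a hfg hg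
    · exact QuotSMulTop.map_surjective a hg

theorem reg_free {xs : List R} (h : IsWeaklyRegular R xs) (q : ℕ) :
    IsWeaklyRegular (Fin q → R) xs :=
  ((TensorProduct.rid R (Fin q → R)).isWeaklyRegular_congr xs).1
    (IsWeaklyRegular.isWeaklyRegular_lTensor (M₂ := Fin q → R) h)

theorem reg_nth [IsLocalRing R] (k : ℕ) : ∀ (xs : List R) (_ : xs.length ≤ k)
    (_ : IsWeaklyRegular R xs) {N M : ModuleCat.{0} R} (_ : IsNthSyzygyOf R k N M),
    IsWeaklyRegular M xs := by
  induction k with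
  | zero =>
    intro xs h _ N M _
    have : xs = [] := by simpa using h
    subst this
    exact IsWeaklyRegular.nil R M
  | succ k ih =>
    intro xs h hxs N M hM
    obtain ⟨B, hB, q, g, hg, hm, ⟨e⟩⟩ := nth_unsnoc k hM
    rcases List.eq_nil_or_concat xs with rfl | ⟨rs, r, rfl⟩
    · exact IsWeaklyRegular.nil R M
    · rw [List.concat_eq_append] at *
      have h1 : IsWeaklyRegular R rs := ((isWeaklyRegular_append_iff R rs [r]).1 hxs).1
      refine reg_ses r rs ((LinearMap.ker g).subtype ∘ₗ e.toLinearMap) g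
        (Subtype.val_injective.comp e.injective) ?_ hg (reg_free hxs q) (ih rs ?_ h1 hB)
      · intro y
        constructor
        · intro hy; exact ⟨e.symm ⟨y, hy⟩, by simp⟩
        · rintro ⟨v, rfl⟩; exact (e v).2
      · simpa using h

end reg

section pascal
variable {R : Type} [CommRing R]

variable (R) in
/-- iterated `Ω ⊕ id` applied to a sequence of syzygies -/
def DD : (ℕ → ModuleCat.{0} R) → ℕ → ModuleCat.{0} R
  | V, 0 => V 0
  | V, (n+1) => ModuleCat.of R (DD (fun k => V (k+1)) n × DD V n)

theorem DD_syz [IsLocalRing R] (n : ℕ) : ∀ (V : ℕ → ModuleCat.{0} R)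
    (_ : ∀ k, Syz R (V k) (V (k+1))), Syz R (DD R V n) (DD R (fun k => V (k+1)) n) := by
  induction n with
  | zero => intro V h; exact h 0
  | succ n ih => intro V h; exact syz_prod (ih _ fun k => h (k+1)) (ih _ h)

theorem DD_fact {x : R} (n : ℕ) : ∀ (V : ℕ → ModuleCat.{0} R)
    (_ : ∀ k, Fact' x (V k)), Fact' x (DD R V n) := by
  induction n with
  | zero => intro V h; exact h 0
  | succ n ih => intro V h; exact fact_prod (ih _ fun k => h (k+1)) (ih _ h)

theorem DD_index (n : ℕ) : ∃ (T : Type) (_ : Fintype T) (w : T → ℕ),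
    (∀ V : ℕ → ModuleCat.{0} R, Nonempty (DD R V n ≃ₗ[R] ((t : T) → V (w t)))) ∧
    ∀ i, Nat.card {t // w t = i} = n.choose i := by
  induction n with
  | zero =>
    refine ⟨Unit, inferInstance, fun _ => 0, fun V => ⟨?_⟩, ?_⟩
    · exact (LinearEquiv.funUnique Unit R (V 0)).symm
    · intro i
      rcases i with _ | i
      · simp
      · have : IsEmpty {t : Unit // 0 = i + 1} := ⟨fun t => by simpa using t.2⟩
        simp
  | succ n ih =>
    obtain ⟨T, _, w, h1, h2⟩ := ih
    refine ⟨T ⊕ T, inferInstance, Sum.elim (fun t => w t + 1) w, fun V => ?_, ?_⟩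
    · obtain ⟨a⟩ := h1 (fun k => V (k+1))
      obtain ⟨b⟩ := h1 V
      exact ⟨(a.prodCongr b).trans (LinearEquiv.sumPiEquivProdPi R T T
        (fun t => (V (Sum.elim (fun t => w t + 1) w t) : Type))).symm⟩
    · intro i
      rw [Nat.card_congr (Equiv.subtypeSum), Nat.card_sum]
      simp only [Sum.elim_inl, Sum.elim_inr]
      rcases i with _ | i
      · rw [h2]; simp
      · rw [h2, Nat.choose_succ_succ, ← h2 i]
        simp

theorem DD_equiv (n : ℕ) (V : ℕ → ModuleCat.{0} R) (W : Fin (n+1) → ModuleCat.{0} R)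
    (h : ∀ i : Fin (n+1), Nonempty (V i ≃ₗ[R] W i)) :
    Nonempty (DD R V n ≃ₗ[R] ((i : Fin (n+1)) → Fin (n.choose i) → ↥(W i))) := by
  obtain ⟨T, _, w, h1, h2⟩ := DD_index (R := R) n
  obtain ⟨a⟩ := h1 V
  have hw : ∀ t, w t < n + 1 := by
    intro t
    by_contra hlt
    have h3 := h2 (w t)
    rw [Nat.choose_eq_zero_of_lt (by omega), Nat.card_eq_zero] at h3
    rcases h3 with h3 | h3
    · exact h3.elim ⟨t, rfl⟩
    · exact h3.not_finite inferInstance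
  let w' : T → Fin (n+1) := fun t => ⟨w t, hw t⟩
  have he : ∀ i : Fin (n+1), Nonempty (Fin (n.choose i) ≃ {t // w' t = i}) := by
    intro i
    have h3 : Nat.card {t // w' t = i} = n.choose i := by
      rw [← h2 i]
      exact Nat.card_congr (Equiv.subtypeEquivRight fun t => by simp [w', Fin.ext_iff])
    exact ⟨(Finite.equivFinOfCardEq h3).symm⟩
  let e := fun i => (he i).some
  let ε : (Σ i : Fin (n+1), Fin (n.choose i)) ≃ T :=
    (Equiv.sigmaCongrRight e).trans (Equiv.sigmaFiberEquiv w')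
  have hε : ∀ s, w (ε s) = (s.1 : ℕ) := by
    rintro ⟨i, j⟩
    exact congrArg Fin.val (e i j).2
  have hc : ∀ s, Nonempty (V (w (ε s)) ≃ₗ[R] W s.1) := by
    intro s
    rw [hε s]
    exact h s.1
  let c := fun s => (hc s).some
  let e1 : ((s : Σ i : Fin (n+1), Fin (n.choose i)) → V (w (ε s))) ≃ₗ[R] ((t : T) → V (w t)) :=
    LinearEquiv.piCongrLeft R (fun t => (V (w t) : Type)) ε
  let e2 : ((s : Σ i : Fin (n+1), Fin (n.choose i)) → V (w (ε s))) ≃ₗ[R]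
      ((s : Σ i : Fin (n+1), Fin (n.choose i)) → W s.1) :=
    LinearEquiv.piCongrRight c
  let e3 : ((s : Σ i : Fin (n+1), Fin (n.choose i)) → W s.1) ≃ₗ[R]
      ((i : Fin (n+1)) → Fin (n.choose i) → ↥(W i)) :=
    LinearEquiv.piCurry R (fun (i : Fin (n+1)) (_ : Fin (n.choose i)) => (W i : Type))
  exact ⟨((a.trans e1.symm).trans e2).trans e3⟩

end pascal

section main
variable {R : Type} [CommRing R] [IsLocalRing R]

theorem exists_seq [IsNoetherianRing R] (A : ModuleCat.{0} R) (hA : Module.Finite R A) :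
    ∃ V : ℕ → ModuleCat.{0} R, V 0 = A ∧ ∀ k, Syz R (V k) (V (k+1)) := by
  have step : ∀ B : {B : ModuleCat.{0} R // Module.Finite R B},
      ∃ C : {B : ModuleCat.{0} R // Module.Finite R B}, Syz R B.1 C.1 := by
    rintro ⟨B, hB⟩
    obtain ⟨q, g, hg, hm⟩ := syz_exists (R := R) B
    exact ⟨⟨ModuleCat.of R (LinearMap.ker g), inferInstanceAs (Module.Finite R (LinearMap.ker g))⟩,
      q, g, hg, hm, ⟨LinearEquiv.refl R _⟩⟩
  choose next hnext using step
  let U : ℕ → {B : ModuleCat.{0} R // Module.Finite R B} :=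
    fun k => Nat.rec ⟨A, hA⟩ (fun _ B => next B) k
  exact ⟨fun k => (U k).1, rfl, fun k => hnext (U k)⟩

open scoped Pointwise in
theorem quot_step (M : Type) [AddCommGroup M] [Module R M] (xs : List R) (j : ℕ)
    (hj : j < xs.length) :
    ∃ p : (M ⧸ (Ideal.ofList (xs.take j) • ⊤ : Submodule R M)) →ₗ[R]
        (M ⧸ (Ideal.ofList (xs.take (j+1)) • ⊤ : Submodule R M)),
      Function.Surjective p ∧ ∀ m, p m = 0 ↔ ∃ m', m = xs[j] • m' := by
  have e : (Ideal.ofList (xs.take (j+1)) • ⊤ : Submodule R M) =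
      (Ideal.ofList (xs.take j) • (⊤ : Submodule R M)) ⊔ (xs[j] • (⊤ : Submodule R M)) := by
    rw [← List.take_append_getElem hj, Ideal.ofList_append, Submodule.sup_smul,
      Ideal.ofList_singleton, Submodule.ideal_span_singleton_smul]
  refine ⟨Submodule.factor (by rw [e]; exact le_sup_left), Submodule.factor_surjective _, ?_⟩
  intro m
  obtain ⟨m, rfl⟩ := Submodule.Quotient.mk_surjective _ m
  change Submodule.Quotient.mk m = 0 ↔ _
  rw [Submodule.Quotient.mk_eq_zero, e, Submodule.mem_sup]
  constructor
  · rintro ⟨y, hy, z, hz, rfl⟩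
    obtain ⟨z, -, rfl⟩ := (Submodule.mem_smul_pointwise_iff_exists _ _ _).1 hz
    refine ⟨Submodule.Quotient.mk z, ?_⟩
    rw [Submodule.Quotient.mk_add, (Submodule.Quotient.mk_eq_zero _).2 hy, zero_add,
      Submodule.Quotient.mk_smul]
  · rintro ⟨m', hm'⟩
    obtain ⟨m', rfl⟩ := Submodule.Quotient.mk_surjective _ m'
    rw [← Submodule.Quotient.mk_smul, Submodule.Quotient.eq] at hm'
    exact ⟨_, hm', _, Submodule.smul_mem_pointwise_smul m' _ _ trivial, by abel⟩

theorem main_ind [IsNoetherianRing R] (M : ModuleCat.{0} R) [Module.Finite R M] (xs : List R)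
    (hxm : ∀ x ∈ xs, x ∈ maximalIdeal R) (hR : IsWeaklyRegular R xs) (hMr : IsWeaklyRegular M xs)
    (V : ℕ → ModuleCat.{0} R) (hV : ∀ k, Syz R (V k) (V (k+1))) (hVM : Syz R (V 0) M)
    (hF : ∀ x ∈ xs, ∀ k, Fact' x (V k)) (j : ℕ) (hj : j < xs.length) :
    ∃ K : ModuleCat.{0} R, IsNthSyzygyOf R j
      (ModuleCat.of R (↥M ⧸ (Ideal.ofList (xs.take (j+1)) • ⊤ : Submodule R ↥M))) K ∧
      Pres R (DD R V (j+1)) K := by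
  induction j with
  | zero =>
    obtain ⟨p, hp, hpk⟩ := quot_step M xs 0 hj
    refine ⟨_, ⟨LinearEquiv.refl R _⟩, ?_⟩
    obtain ⟨k⟩ := syz_unique (hV 0) hVM
    have hx0 : IsSMulRegular R xs[0] := by
      cases xs with
      | nil => simp at hj
      | cons x t => exact ((isWeaklyRegular_cons_iff R x t).1 hR).1
    refine pres_base (Q := V 0) (K := V 1) (hF _ (List.getElem_mem hj) 0) (hV 0) hx0
      (p ∘ₗ Submodule.mkQ _ ∘ₗ k.toLinearMap)
      (hp.comp ((Submodule.mkQ_surjective _).comp k.surjective)) ?_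
    intro m
    change p (Submodule.Quotient.mk (k m)) = 0 ↔ _
    rw [hpk]
    have hbot : (Ideal.ofList (xs.take 0) • ⊤ : Submodule R M) = ⊥ := by simp
    constructor
    · rintro ⟨m', hm'⟩
      obtain ⟨m', rfl⟩ := Submodule.Quotient.mk_surjective _ m'
      rw [← Submodule.Quotient.mk_smul, Submodule.Quotient.eq, hbot, Submodule.mem_bot,
        sub_eq_zero] at hm'
      exact ⟨k.symm m', by rw [← map_smul, ← hm']; simp⟩
    · rintro ⟨m', rfl⟩
      exact ⟨Submodule.Quotient.mk (k m'), by rw [map_smul, Submodule.Quotient.mk_smul]⟩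
  | succ j ih =>
    obtain ⟨K, hK, hP⟩ := ih (by omega)
    obtain ⟨p, hp, hpk⟩ := quot_step M xs (j+1) hj
    have hx := hxm _ (List.getElem_mem hj)
    obtain ⟨E, hE⟩ := isE_exists (R := R) xs[j+1]
      (↥M ⧸ (Ideal.ofList (xs.take (j+1)) • ⊤ : Submodule R ↥M))
    have hE1 := isE_syz hx hE (hMr.regular_mod_prev (j+1) hj) p hp hpk
    obtain ⟨K', E', h1, h2, h3⟩ := isE_nth hx j (Q := ModuleCat.of R
      (↥M ⧸ (Ideal.ofList (xs.take (j+1)) • ⊤ : Submodule R ↥M))) (E := E) hE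
    obtain ⟨k⟩ := nth_unique j hK h1
    refine ⟨E', ⟨E, hE1, h3⟩, ?_⟩
    exact pres_step (pres_congr (LinearEquiv.refl R _) k hP)
      (DD_fact _ V (hF _ (List.getElem_mem hj))) (DD_syz _ V hV) h2

theorem fact_nth {x : R} (n : ℕ) : ∀ {N K : ModuleCat.{0} R}
    (_ : Fact' x N) (_ : IsNthSyzygyOf R n N K), Fact' x K := by
  induction n with
  | zero => rintro N K h ⟨i⟩; exact fact_congr i.symm h
  | succ n ih =>
    rintro N K h ⟨L, ⟨q, g, hg, hm, ⟨i⟩⟩, hK⟩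
    exact ih (fact_congr i.symm (fact_ker h g hg)) hK

end main
end SyzAux

open SyzAux

/-- Proposition 2.9: a short exact sequence
`0 → F → ⊕_{i=0}^{n} (Ω^{i+n-1} N)^{C(n,i)} → Ω^{n-1}(M/(x₁,…,xₙ)M) → 0` with `F` free. -/
theorem ses_syzygies_of_quotient
    (R : Type) [CommRing R] [IsNoetherianRing R] [IsLocalRing R]
    (N : ModuleCat.{0} R) [Module.Finite R N] [Nontrivial N]
    (n : ℕ) (hn : 1 ≤ n)
    (M : ModuleCat.{0} R) (hM : IsNthSyzygyOf R n N M)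
    (xs : List R) (hlen : xs.length = n)
    (hreg : RingTheory.Sequence.IsRegular R xs)
    (ΩN : ModuleCat.{0} R) (hΩ : IsSyzygyOf R N ΩN)
    (hann : ∀ x ∈ xs, SMulExtZero R x 1 N ΩN)
    (W : Fin (n+1) → ModuleCat.{0} R)
    (hW : ∀ i : Fin (n+1), IsNthSyzygyOf R ((i : ℕ) + n - 1) N (W i))
    (Z : ModuleCat.{0} R)
    (hZ : IsNthSyzygyOf R (n-1)
      (ModuleCat.of R (↥M ⧸ (Ideal.ofList xs • ⊤ : Submodule R ↥M))) Z) :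
    ∃ (q : ℕ) (f : (Fin q → R) →ₗ[R] ((i : Fin (n+1)) → Fin (n.choose i) → ↥(W i)))
      (g : ((i : Fin (n+1)) → Fin (n.choose i) → ↥(W i)) →ₗ[R] ↥Z),
      Function.Injective f ∧ Function.Surjective g ∧ LinearMap.range f = LinearMap.ker g := by
  obtain ⟨m, rfl⟩ : ∃ m, n = m + 1 := ⟨n - 1, by omega⟩
  obtain ⟨A, hA, hAM⟩ := nth_unsnoc m hM
  have hAfin : Module.Finite R A := nth_finite m inferInstance hA
  have hMfin : Module.Finite R M := syz_finite hAM
  obtain ⟨V, hV0, hV⟩ := exists_seq A hAfin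
  subst hV0
  have hVn : ∀ k, IsNthSyzygyOf R (m + k) N (V k) := by
    intro k
    induction k with
    | zero => exact hA
    | succ k ih => exact nth_snoc _ ih (hV k)
  have hxm : ∀ x ∈ xs, x ∈ maximalIdeal R := by
    intro x hx
    have h1 : Ideal.ofList xs ≠ ⊤ := by
      intro h
      apply hreg.top_ne_smul
      rw [h]; simp
    exact IsLocalRing.le_maximalIdeal h1 (Ideal.subset_span hx)
  have hF : ∀ x ∈ xs, ∀ k, Fact' x (V k) := by
    intro x hx k
    refine fact_nth _ ?_ (hVn k)
    obtain ⟨q, g, hg, hm, ⟨e⟩⟩ := hΩ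
    obtain ⟨s, hs⟩ := lift_of_ext x N ΩN (hann x hx) g hg e
    exact ⟨q, s, g, hs⟩
  obtain ⟨K, hK, hP⟩ := main_ind M xs hxm hreg.toIsWeaklyRegular
    (reg_nth _ xs hlen.le hreg.toIsWeaklyRegular hM) V hV hAM hF m (by omega)
  have htake : xs.take (m + 1) = xs := by rw [← hlen, List.take_length]
  rw [htake] at hK
  obtain ⟨z⟩ := nth_unique m hK hZ
  have hWV : ∀ i : Fin (m + 1 + 1), Nonempty (V i ≃ₗ[R] W i) := by
    intro i
    have h1 := hW i
    rw [show (i : ℕ) + (m + 1) - 1 = m + i by omega] at h1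
    exact nth_unique _ (hVn i) h1
  obtain ⟨d⟩ := DD_equiv (m + 1) V W hWV
  obtain ⟨q, f, g, hf, hg, hfg, -⟩ := pres_congr d z hP
  exact ⟨q, f, g, hf, hg, hfg⟩
end

section
/- Let R be a commutative Noetherian local ring, A a nonzero finitely generated R-module, B a finitely generated R-module, and m ≥ 1, r ≥ 0 integers. Assume that the Auslander transpose Tr Ω_R^m B is an r-th syzygy module and that Ω_R^r A is Tor-rigid. If Ext_R^m(B, A) = 0, then Ext_R^m(B, R) = 0. -/
open CategoryTheory IsLocalRing

section Generic
open Limits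
universe v u v' u'
variable {C : Type u} [Category.{v} C] [Abelian C] 

/-- unbundled form of being a projective resolution -/
structure IsRes (X : ChainComplex C ℕ) {Z : C} (ε : X.X 0 ⟶ Z) : Prop where
  proj : ∀ n, Projective (X.X n)
  w : X.d 1 0 ≫ ε = 0
  epi : Epi ε
  ex0 : (ShortComplex.mk _ _ w).Exact
  ex : ∀ n, (ShortComplex.mk _ _ (X.d_comp_d (n + 2) (n + 1) n)).Exact

lemma exists_isRes [EnoughProjectives C] (Z : C) : ∃ (X : ChainComplex C ℕ) (ε : X.X 0 ⟶ Z), IsRes X ε := by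
  let P := ProjectiveResolution.of Z
  let ε : P.complex.X 0 ⟶ Z := P.π.f 0
  refine ⟨P.complex, ε, ⟨fun n => P.projective n, P.complex_d_comp_π_f_zero, ?_, ?_, P.exact_succ⟩⟩
  · exact inferInstanceAs (Epi (P.π.f 0))
  · exact P.exact₀

lemma IsRes.exists_res {X : ChainComplex C ℕ} {Z : C} {ε : X.X 0 ⟶ Z} (h : IsRes X ε) :
    ∃ P : ProjectiveResolution Z, P.complex = X := by
  have := h.epi
  refine ⟨{ complex := X, projective := h.proj, π := (ChainComplex.toSingle₀Equiv _ _).symm ⟨ε, h.w⟩, quasiIso := ⟨fun n => ?_⟩}, rfl⟩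
  cases n with
  | zero => 
    rw [ChainComplex.quasiIsoAt₀_iff, ShortComplex.quasiIso_iff_of_zeros']
    · refine (ShortComplex.exact_and_epi_g_iff_of_iso ?_).2 ⟨h.ex0, by dsimp; infer_instance⟩
      refine ShortComplex.isoMk (Iso.refl _) (Iso.refl _) (Iso.refl _) ?_ ?_
      · exact (Category.id_comp _).trans (Category.comp_id _).symm
      · refine (Category.id_comp _).trans (Eq.trans ?_ (Category.comp_id _).symm)
        exact (ChainComplex.toSingle₀Equiv_symm_apply_f_zero ε h.w).symm
    · exact X.shape _ _ (by simp)
    all_goals rfl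
  | succ n =>
    rw [quasiIsoAt_iff_exactAt']
    · rw [HomologicalComplex.exactAt_iff' _ (n + 1 + 1) (n + 1) n (by simp) (by simp)]
      exact h.ex n
    · apply ChainComplex.exactAt_succ_single_obj

lemma IsRes.augment (S : ShortComplex C) (hS : S.ShortExact) [Projective S.X₂]
    {X : ChainComplex C ℕ} {ε : X.X 0 ⟶ S.X₁} (h : IsRes X ε) :
    IsRes (ChainComplex.augment X (ε ≫ S.f) (by rw [← Category.assoc, h.w, zero_comp])) 
      (show _ ⟶ S.X₃ from S.g) := by
  have := hS.mono_f
  have := hS.epi_g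
  have := h.epi
  have w : (ε ≫ S.f) ≫ S.g = 0 := by rw [Category.assoc, S.zero, comp_zero]
  refine ⟨?_, ?_, ?_, ?_, ?_⟩
  · intro n
    cases n with
    | zero => change Projective S.X₂; infer_instance
    | succ n => exact h.proj n
  · exact w
  · exact hS.epi_g
  · let φ : (ShortComplex.mk (ε ≫ S.f) S.g w) ⟶ S := 
      { τ₁ := ε, τ₂ := 𝟙 _, τ₃ := 𝟙 _ , comm₁₂ := by simp, comm₂₃ := by simp}
    have : Epi φ.τ₁ := h.epi
    have : IsIso φ.τ₂ := inferInstanceAs (IsIso (𝟙 _))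
    have : Mono φ.τ₃ := inferInstanceAs (Mono (𝟙 _))
    exact (ShortComplex.exact_iff_of_epi_of_isIso_of_mono φ).2 hS.exact
  · intro n
    cases n with
    | zero => 
      have w' : X.d 1 0 ≫ (ε ≫ S.f) = 0 := by rw [← Category.assoc, h.w, zero_comp]
      let φ : (ShortComplex.mk (X.d 1 0) ε h.w) ⟶ (ShortComplex.mk (X.d 1 0) (ε ≫ S.f) w')  := 
        { τ₁ := 𝟙 _, τ₂ := 𝟙 _, τ₃ := S.f , comm₁₂ := by simp, comm₂₃ := by simp}
      have : Epi φ.τ₁ := inferInstanceAs (Epi (𝟙 _))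
      have : IsIso φ.τ₂ := inferInstanceAs (IsIso (𝟙 _))
      have : Mono φ.τ₃ := hS.mono_f
      exact (ShortComplex.exact_iff_of_epi_of_isIso_of_mono φ).1 h.ex0
    | succ n => exact h.ex n

variable {D : Type u'} [Category.{v'} D] [Abelian D] 

lemma IsRes.isZero_iff [EnoughProjectives C] (G : C ⥤ D) [G.Additive] {X : ChainComplex C ℕ} {Z : C} {ε : X.X 0 ⟶ Z} (h : IsRes X ε)
    (n : ℕ) : IsZero ((G.leftDerived (n+1)).obj Z) ↔
      (ShortComplex.mk (G.map (X.d (n+2) (n+1))) (G.map (X.d (n+1) n)) (by rw [← G.map_comp, X.d_comp_d, G.map_zero])).Exact := by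
  obtain ⟨P, rfl⟩ := h.exists_res
  rw [(P.isoLeftDerivedObj G (n+1)).isZero_iff]
  refine (HomologicalComplex.exactAt_iff_isZero_homology _ _).symm.trans ?_
  rw [HomologicalComplex.exactAt_iff' _ (n + 1 + 1) (n + 1) n (by simp) (by simp)]
  rfl

lemma isZero_shift [EnoughProjectives C] (G : C ⥤ D) [G.Additive] (S : ShortComplex C) (hS : S.ShortExact) [Projective S.X₂]
    (n : ℕ) : IsZero ((G.leftDerived (n+2)).obj S.X₃) ↔ IsZero ((G.leftDerived (n+1)).obj S.X₁) := by
  obtain ⟨X, ε, h⟩ := exists_isRes S.X₁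
  rw [h.isZero_iff G, (h.augment S hS).isZero_iff G]
  rfl

lemma isZero_one [EnoughProjectives C] (G : C ⥤ D) [G.Additive] [PreservesFiniteColimits G] 
    (S : ShortComplex C) (hS : S.ShortExact) [Projective S.X₂] :
    IsZero ((G.leftDerived 1).obj S.X₃) ↔ Mono (G.map S.f) := by
  obtain ⟨X, ε, h⟩ := exists_isRes S.X₁
  have := h.epi
  have w' : X.d 1 0 ≫ (ε ≫ S.f) = 0 := by rw [← Category.assoc, h.w, zero_comp]
  have w1 : G.map (X.d 1 0) ≫ G.map ε = 0 := by rw [← G.map_comp, h.w, G.map_zero]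
  have w2 : G.map (X.d 1 0) ≫ G.map (ε ≫ S.f) = 0 := by rw [← G.map_comp, w', G.map_zero]
  have h0 : (ShortComplex.mk _ _ w1).Exact := 
    h.ex0.map_of_epi_of_preservesCokernel G h.epi inferInstance
  rw [(h.augment S hS).isZero_iff G]
  change (ShortComplex.mk _ _ w2).Exact ↔ _
  constructor
  · intro hex
    refine Preadditive.mono_of_cancel_zero _ fun {A} a ha => ?_
    obtain ⟨A', p, hp, x, hx⟩ := surjective_up_to_refinements_of_epi (G.map ε) a
    rw [ShortComplex.exact_iff_exact_up_to_refinements] at hex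
    obtain ⟨A'', p', hp', y, hy⟩ := hex x (by
      change x ≫ G.map (ε ≫ S.f) = 0
      rw [G.map_comp, ← Category.assoc, ← hx, Category.assoc, ha, comp_zero])
    change _ = y ≫ G.map (X.d 1 0) at hy
    rw [← cancel_epi p, ← cancel_epi p', hx, ← Category.assoc, hy, Category.assoc, w1]
    simp
  · intro hm
    let φ : (ShortComplex.mk _ _ w1) ⟶ (ShortComplex.mk _ _ w2)  := 
      { τ₁ := 𝟙 _, τ₂ := 𝟙 _, τ₃ := G.map S.f , comm₁₂ := by simp, comm₂₃ := by simp}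
    have : Epi φ.τ₁ := inferInstanceAs (Epi (𝟙 _))
    have : IsIso φ.τ₂ := inferInstanceAs (IsIso (𝟙 _))
    have : Mono φ.τ₃ := hm
    exact (ShortComplex.exact_iff_of_epi_of_isIso_of_mono φ).1 h0

instance (R : Type) [CommRing R] (A : ModuleCat.{0} R) : PreservesFiniteColimits ((linearYoneda R (ModuleCat.{0} R)).obj A).rightOp := by
  have : PreservesLimits ((linearYoneda R (ModuleCat.{0} R)).obj A ⋙ forget _) := 
    inferInstanceAs (PreservesLimits (yoneda.obj A))
  have : PreservesLimits ((linearYoneda R (ModuleCat.{0} R)).obj A) := 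
    preservesLimits_of_reflects_of_preserves _ (forget _)
  have := preservesColimits_rightOp ((linearYoneda R (ModuleCat.{0} R)).obj A)
  infer_instance

end Generic

section Bridge
open Limits
variable {R : Type} [CommRing R] 

lemma se_of {K F N : ModuleCat.{0} R} (i : K →ₗ[R] F) (g : F →ₗ[R] N)
    (hi : Function.Injective i) (hg : Function.Surjective g) (h : Function.Exact i g) :
    ∃ w, (ShortComplex.mk (ModuleCat.ofHom i) (ModuleCat.ofHom g) w).ShortExact := by
  refine ⟨by ext x; exact h.apply_apply_eq_zero x, ?_⟩
  refine { exact := ?_, mono_f := ?_, epi_g := ?_ }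
  · rw [ShortComplex.ShortExact.moduleCat_exact_iff_function_exact]; exact h
  · exact (ModuleCat.mono_iff_injective _).2 hi
  · exact (ModuleCat.epi_iff_surjective _).2 hg

lemma proj_of (F : ModuleCat.{0} R) [Module.Projective R F] : Projective F :=
  (IsProjective.iff_projective F).1 inferInstance

section
variable {K F N : ModuleCat.{0} R} [Module.Projective R F] (i : K →ₗ[R] F) (g : F →ₗ[R] N)
    (hi : Function.Injective i) (hg : Function.Surjective g) (h : Function.Exact i g)

lemma tor_shift [IsNoetherianRing R] (M : ModuleCat.{0} R) (hi : Function.Injective i)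
    (hg : Function.Surjective g) (h : Function.Exact i g) (n : ℕ) :
    TorZero R (n+2) M N ↔ TorZero R (n+1) M K := by
  obtain ⟨w, hS⟩ := se_of i g hi hg h
  have := proj_of F
  rw [TorZero, TorZero, ← ModuleCat.isZero_iff_subsingleton, ← ModuleCat.isZero_iff_subsingleton]
  exact isZero_shift ((MonoidalCategory.tensoringLeft (ModuleCat.{0} R)).obj M) _ hS n

lemma tor_one [IsNoetherianRing R] (M : ModuleCat.{0} R) (hi : Function.Injective i)
    (hg : Function.Surjective g) (h : Function.Exact i g) :
    TorZero R 1 M N ↔ Function.Injective (i.lTensor M) := by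
  obtain ⟨w, hS⟩ := se_of i g hi hg h
  have := proj_of F
  rw [TorZero, ← ModuleCat.isZero_iff_subsingleton]
  refine (isZero_one ((MonoidalCategory.tensoringLeft (ModuleCat.{0} R)).obj M) _ hS).trans ?_
  exact ModuleCat.mono_iff_injective _

lemma ext_shift (M : ModuleCat.{0} R) (hi : Function.Injective i)
    (hg : Function.Surjective g) (h : Function.Exact i g) (n : ℕ) :
    ExtZero R (n+2) N M ↔ ExtZero R (n+1) K M := by
  obtain ⟨w, hS⟩ := se_of i g hi hg h
  have := proj_of F
  rw [ExtZero, ExtZero, ← ModuleCat.isZero_iff_subsingleton, ← ModuleCat.isZero_iff_subsingleton]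
  have := isZero_shift ((linearYoneda R (ModuleCat.{0} R)).obj M).rightOp _ hS n
  exact ⟨fun h => (this.1 h.op).unop, fun h => (this.2 h.op).unop⟩

lemma ext_one (M : ModuleCat.{0} R) (hi : Function.Injective i)
    (hg : Function.Surjective g) (h : Function.Exact i g) :
    ExtZero R 1 N M ↔ ∀ φ : K →ₗ[R] M, ∃ ψ : F →ₗ[R] M, ψ ∘ₗ i = φ := by
  obtain ⟨w, hS⟩ := se_of i g hi hg h
  have := proj_of F
  rw [ExtZero, ← ModuleCat.isZero_iff_subsingleton]
  have h1 := isZero_one ((linearYoneda R (ModuleCat.{0} R)).obj M).rightOp _ hS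
  have h2 : Mono (((linearYoneda R (ModuleCat.{0} R)).obj M).rightOp.map (ModuleCat.ofHom i)) ↔
      Epi (((linearYoneda R (ModuleCat.{0} R)).obj M).map (ModuleCat.ofHom i).op) := 
    ⟨fun h => CategoryTheory.unop_epi_of_mono (((linearYoneda R (ModuleCat.{0} R)).obj M).rightOp.map (ModuleCat.ofHom i)), 
      fun h => CategoryTheory.op_mono_of_epi (((linearYoneda R (ModuleCat.{0} R)).obj M).map (ModuleCat.ofHom i).op)⟩
  have h3 : IsZero (((Ext R (ModuleCat.{0} R) 1).obj (Opposite.op N)).obj M) ↔ 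
     Epi (((linearYoneda R (ModuleCat.{0} R)).obj M).map (ModuleCat.ofHom i).op) := 
    ⟨fun h => h2.1 (h1.1 h.op), fun h => (h1.2 (h2.2 h)).unop⟩
  rw [h3, ModuleCat.epi_iff_surjective]
  constructor
  · intro h φ
    obtain ⟨ψ, hψ⟩ := h (ModuleCat.ofHom φ)
    exact ⟨ψ.hom, congrArg ModuleCat.Hom.hom hψ⟩
  · intro h φ
    obtain ⟨ψ, hψ⟩ := h φ.hom
    exact ⟨ModuleCat.ofHom ψ, ModuleCat.hom_ext hψ⟩
end

lemma tor_congr_right [IsNoetherianRing R] (M : ModuleCat.{0} R) {N N' : ModuleCat.{0} R} (e : N ≃ₗ[R] N') (n : ℕ) :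
    TorZero R n M N ↔ TorZero R n M N' := 
  (((Tor (ModuleCat.{0} R) n).obj M).mapIso e.toModuleIso).toLinearEquiv.toEquiv.subsingleton_congr

lemma tor_congr_left [IsNoetherianRing R] (M : ModuleCat.{0} R) {N N' : ModuleCat.{0} R} (e : N ≃ₗ[R] N') (n : ℕ) :
    TorZero R n N M ↔ TorZero R n N' M := 
  (((Tor (ModuleCat.{0} R) n).mapIso e.toModuleIso).app M).toLinearEquiv.toEquiv.subsingleton_congr

lemma ext_congr (M : ModuleCat.{0} R) {N N' : ModuleCat.{0} R} (e : N ≃ₗ[R] N') (n : ℕ) :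
    ExtZero R n N M ↔ ExtZero R n N' M := 
  (((Ext R (ModuleCat.{0} R) n).mapIso e.toModuleIso.symm.op).app M).toLinearEquiv.toEquiv.subsingleton_congr

end Bridge

section Algebra
open TensorProduct
variable {R : Type} [CommRing R]

/-- half of the symmetry of `Tor₁` -/
lemma sym_inj {L G K K' F' M : Type} [AddCommGroup L] [AddCommGroup G] [AddCommGroup K]
    [AddCommGroup K'] [AddCommGroup F'] [AddCommGroup M] [Module R L] [Module R G] [Module R K]
    [Module R K'] [Module R F'] [Module R M] [Module.Flat R F']
    (l : L →ₗ[R] G) (k : G →ₗ[R] K) (i : K' →ₗ[R] F') (g : F' →ₗ[R] M)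
    (hl : Function.Injective l) (hk : Function.Surjective k) (hlk : Function.Exact l k)
    (hg : Function.Surjective g) (hig : Function.Exact i g)
    (h : Function.Injective (i.rTensor K)) : Function.Injective (l.lTensor M) := by
  rw [injective_iff_map_eq_zero]
  intro z hz
  obtain ⟨y, rfl⟩ := LinearMap.rTensor_surjective L hg z
  have comm : ∀ {X X' Y Y' : Type} [AddCommGroup X] [AddCommGroup X'] [AddCommGroup Y]
      [AddCommGroup Y'] [Module R X] [Module R X'] [Module R Y] [Module R Y']
      (a : X →ₗ[R] X') (b : Y →ₗ[R] Y') (t : X ⊗[R] Y),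
      b.lTensor X' (a.rTensor Y t) = a.rTensor Y' (b.lTensor X t) := by
    intro X X' Y Y' _ _ _ _ _ _ _ _ a b t
    rw [← LinearMap.comp_apply, ← LinearMap.comp_apply, LinearMap.lTensor_comp_rTensor,
      LinearMap.rTensor_comp_lTensor]
  rw [comm] at hz
  obtain ⟨x, hx⟩ := (rTensor_exact G hig hg _).1 hz
  have h1 : k.lTensor K' x = 0 := by
    apply h
    rw [← comm, hx, map_zero, ← LinearMap.comp_apply, ← LinearMap.lTensor_comp,
      hlk.linearMap_comp_eq_zero]
    simp
  obtain ⟨w, rfl⟩ := (lTensor_exact K' hlk hk _).1 h1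
  rw [← comm] at hx
  have := Module.Flat.lTensor_preserves_injective_linearMap (M := F') l hl hx
  rw [← this, ← LinearMap.comp_apply, ← LinearMap.rTensor_comp, hig.linearMap_comp_eq_zero]
  simp

lemma inj_comm {X Y Z : Type} [AddCommGroup X] [AddCommGroup Y] [AddCommGroup Z]
    [Module R X] [Module R Y] [Module R Z] (a : X →ₗ[R] Y) :
    Function.Injective (a.rTensor Z) ↔ Function.Injective (a.lTensor Z) := by
  have : ⇑(a.lTensor Z) = TensorProduct.comm R Y Z ∘ a.rTensor Z ∘ TensorProduct.comm R Z X := by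
    have : a.lTensor Z = (TensorProduct.comm R Y Z).toLinearMap ∘ₗ a.rTensor Z ∘ₗ
      (TensorProduct.comm R Z X).toLinearMap := by ext; simp
    rw [this]; rfl
  rw [this]
  simp

lemma sym_inj_iff {L G K K' F' M : Type} [AddCommGroup L] [AddCommGroup G] [AddCommGroup K]
    [AddCommGroup K'] [AddCommGroup F'] [AddCommGroup M] [Module R L] [Module R G] [Module R K]
    [Module R K'] [Module R F'] [Module R M] [Module.Flat R F'] [Module.Flat R G]
    (l : L →ₗ[R] G) (k : G →ₗ[R] K) (i : K' →ₗ[R] F') (g : F' →ₗ[R] M)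
    (hl : Function.Injective l) (hk : Function.Surjective k) (hlk : Function.Exact l k)
    (hi : Function.Injective i) (hg : Function.Surjective g) (hig : Function.Exact i g) :
    Function.Injective (i.rTensor K) ↔ Function.Injective (l.lTensor M) := by
  refine ⟨sym_inj l k i g hl hk hlk hg hig, fun h => ?_⟩
  rw [inj_comm]
  exact sym_inj i g l k hi hg hig hk hlk (inj_comm l |>.2 h)

/-- a free cover -/
lemma exists_cover (N : ModuleCat.{0} R) : ∃ (K F : ModuleCat.{0} R) (_ : Module.Projective R F)
    (i : K →ₗ[R] F) (g : F →ₗ[R] N), Function.Injective i ∧ Function.Surjective g ∧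
      Function.Exact i g := by
  let g : (N →₀ R) →ₗ[R] N := Finsupp.linearCombination R id
  refine ⟨ModuleCat.of R (LinearMap.ker g), ModuleCat.of R (N →₀ R), 
    inferInstanceAs (Module.Projective R (N →₀ R)), (LinearMap.ker g).subtype, g,
    Subtype.val_injective, ?_, ?_⟩
  · exact Finsupp.linearCombination_id_surjective R N
  · exact LinearMap.exact_subtype_ker_map g

lemma tor_swap [IsNoetherianRing R] {K' F' M : ModuleCat.{0} R} [Module.Projective R F']
    (i' : K' →ₗ[R] F') (g' : F' →ₗ[R] M) (hi' : Function.Injective i')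
    (hg' : Function.Surjective g') (h' : Function.Exact i' g') (n : ℕ) (N : ModuleCat.{0} R) :
    TorZero R (n+1) K' N ↔ TorZero R (n+2) M N := by
  induction n generalizing N with
  | zero =>
    obtain ⟨K, F, _, i, g, hi, hg, h⟩ := exists_cover N
    obtain ⟨L, G, _, l, k, hl, hk, hlk⟩ := exists_cover K
    rw [tor_one i g K' hi hg h, tor_shift i g M hi hg h, tor_one l k M hl hk hlk,
      ← sym_inj_iff l k i' g' hl hk hlk hi' hg' h']
    have e : i.lTensor F' ∘ₗ i'.rTensor K = i'.rTensor F ∘ₗ i.lTensor K' := by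
      rw [LinearMap.lTensor_comp_rTensor, LinearMap.rTensor_comp_lTensor]
    have e1 : Function.Injective (i.lTensor F') :=
      Module.Flat.lTensor_preserves_injective_linearMap i hi
    have e2 : Function.Injective (i'.rTensor F) :=
      Module.Flat.rTensor_preserves_injective_linearMap i' hi'
    rw [← e1.of_comp_iff (i'.rTensor K), ← e2.of_comp_iff (i.lTensor K')]
    exact Iff.of_eq (congrArg Function.Injective (congrArg DFunLike.coe e).symm)
  | succ n ih =>
    obtain ⟨K, F, _, i, g, hi, hg, h⟩ := exists_cover N
    rw [tor_shift i g K' hi hg h, tor_shift i g M hi hg h, ih]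

lemma tor_prod [IsNoetherianRing R] (M N : ModuleCat.{0} R) (p n : ℕ) :
    TorZero R (n+1) M (ModuleCat.of R (N × (Fin p → R))) ↔ TorZero R (n+1) M N := by
  obtain ⟨K, F, _, i, g, hi, hg, h⟩ := exists_cover N
  let F2 : ModuleCat.{0} R := ModuleCat.of R (F × (Fin p → R))
  have : Module.Projective R F2 := inferInstanceAs (Module.Projective R (F × (Fin p → R)))
  let i2 : K →ₗ[R] F2 := LinearMap.inl R F (Fin p → R) ∘ₗ i
  let g2 : F2 →ₗ[R] (ModuleCat.of R (N × (Fin p → R))) := LinearMap.prodMap g LinearMap.id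
  have hi2 : Function.Injective i2 := LinearMap.inl_injective.comp hi
  have hg2 : Function.Surjective g2 := by
    rintro ⟨a, b⟩
    obtain ⟨a, rfl⟩ := hg a
    exact ⟨(a, b), rfl⟩
  have h2 : Function.Exact i2 g2 := by
    rintro ⟨a, b⟩
    constructor
    · intro h0
      have ha : g a = 0 := congrArg Prod.fst h0
      have hb : b = 0 := congrArg Prod.snd h0
      obtain ⟨c, rfl⟩ := (h a).1 ha
      subst hb
      exact ⟨c, rfl⟩
    · rintro ⟨c, hc⟩
      have ha : i c = a := congrArg Prod.fst hc
      have hb : 0 = b := congrArg Prod.snd hc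
      subst hb ha
      change (g (i c), (0 : Fin p → R)) = 0
      rw [h.apply_apply_eq_zero]; rfl
  cases n with
  | zero =>
    rw [tor_one i g M hi hg h, tor_one i2 g2 M hi2 hg2 h2]
    have e : i2.lTensor M = (LinearMap.inl R F (Fin p → R)).lTensor M ∘ₗ i.lTensor M :=
      LinearMap.lTensor_comp _ _ _
    have e1 : Function.Injective ((LinearMap.inl R F (Fin p → R)).lTensor M) := by
      refine Function.LeftInverse.injective (g := (LinearMap.fst R F (Fin p → R)).lTensor M) ?_
      intro x
      rw [← LinearMap.comp_apply, ← LinearMap.lTensor_comp, LinearMap.fst_comp_inl]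
      simp
    rw [← e1.of_comp_iff (i.lTensor M), e]
    rfl
  | succ n =>
    rw [tor_shift i g M hi hg h, tor_shift i2 g2 M hi2 hg2 h2]

section syz
variable [IsLocalRing R]

lemma IsSyzygyOf.data {N K : ModuleCat.{0} R} (h : IsSyzygyOf R N K) :
    ∃ (q : ℕ) (i : K →ₗ[R] (ModuleCat.of R (Fin q → R)))
      (g : (ModuleCat.of R (Fin q → R)) →ₗ[R] N), Function.Injective i ∧ Function.Surjective g ∧
      Function.Exact i g := by
  obtain ⟨q, g, hg, -, ⟨e⟩⟩ := h
  refine ⟨q, (LinearMap.ker g).subtype ∘ₗ e.toLinearMap, g, ?_, hg, ?_⟩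
  · exact Subtype.val_injective.comp e.injective
  · intro x
    constructor
    · intro hx
      obtain ⟨y, hy⟩ := e.surjective ⟨x, hx⟩
      exact ⟨y, congrArg Subtype.val hy⟩
    · rintro ⟨y, rfl⟩
      exact (e y).2

instance (q : ℕ) : Module.Projective R (ModuleCat.of R (Fin q → R)) :=
  inferInstanceAs (Module.Projective R (Fin q → R))

lemma tor_nth_left [IsNoetherianRing R] (r n : ℕ) (A D Y : ModuleCat.{0} R)
    (h : IsNthSyzygyOf R r A D) : TorZero R (n+1) D Y ↔ TorZero R (n+r+1) A Y := by
  induction r generalizing A with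
  | zero => obtain ⟨e⟩ := h; exact tor_congr_left Y e _
  | succ r ih =>
    obtain ⟨K, hK, h⟩ := h
    obtain ⟨q, i, g, hi, hg, hig⟩ := hK.data
    rw [ih K h]
    exact tor_swap i g hi hg hig _ _

lemma tor_nth_right [IsNoetherianRing R] (r n : ℕ) (A D Y : ModuleCat.{0} R)
    (h : IsNthSyzygyOf R r A D) : TorZero R (n+1) Y D ↔ TorZero R (n+r+1) Y A := by
  induction r generalizing A with
  | zero => obtain ⟨e⟩ := h; exact tor_congr_right Y e _
  | succ r ih =>
    obtain ⟨K, hK, h⟩ := h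
    obtain ⟨q, i, g, hi, hg, hig⟩ := hK.data
    rw [ih K h]
    exact (tor_shift i g Y hi hg hig _).symm

lemma ext_nth (n : ℕ) (B C : ModuleCat.{0} R) (h : IsNthSyzygyOf R (n+1) B C) :
    ∃ (K : ModuleCat.{0} R) (q : ℕ) (i : C →ₗ[R] (ModuleCat.of R (Fin q → R)))
      (g : (ModuleCat.of R (Fin q → R)) →ₗ[R] K), Function.Injective i ∧ Function.Surjective g ∧
      Function.Exact i g ∧ ∀ M, ExtZero R (n+1) B M ↔ ExtZero R 1 K M := by
  induction n generalizing B with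
  | zero =>
    obtain ⟨K, hK, ⟨e⟩⟩ := h
    obtain ⟨q, i, g, hi, hg, hig⟩ := hK.data
    refine ⟨B, q, i ∘ₗ e.toLinearMap, g, hi.comp e.injective, hg, ?_, fun M => Iff.rfl⟩
    intro x
    rw [hig x]
    exact (e.surjective.exists (p := fun y => i y = x))
  | succ n ih =>
    obtain ⟨K, hK, h⟩ := h
    obtain ⟨q, i, g, hi, hg, hig⟩ := hK.data
    obtain ⟨K', q', i', g', h1, h2, h3, h4⟩ := ih K h
    exact ⟨K', q', i', g', h1, h2, h3, fun M => (ext_shift i g M hi hg hig n).trans (h4 M)⟩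

lemma nakayama_tensor {A E : Type} [AddCommGroup A] [AddCommGroup E] [Module R A] [Module R E]
    [Module.Finite R A] [Module.Finite R E] [Nontrivial A] [Subsingleton (A ⊗[R] E)] :
    Subsingleton E := by
  have h1 : Nontrivial (ResidueField R ⊗[R] A) := by
    rw [← not_subsingleton_iff_nontrivial, IsLocalRing.subsingleton_tensorProduct,
      not_subsingleton_iff_nontrivial]
    infer_instance
  obtain ⟨v, hv⟩ := exists_ne (0 : ResidueField R ⊗[R] A)
  have h2 : ∃ φ : Module.Dual (ResidueField R) (ResidueField R ⊗[R] A), φ v ≠ 0 := by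
    by_contra! hh
    exact hv ((Module.forall_dual_apply_eq_zero_iff _ v).1 hh)
  obtain ⟨φ, hφ⟩ := h2
  have hφs : Function.Surjective φ := fun c => ⟨(c / φ v) • v, by simp [hφ]⟩
  let ψ : A →ₗ[R] ResidueField R := φ.restrictScalars R ∘ₗ TensorProduct.mk R (ResidueField R) A 1
  have hψ : Function.Surjective ψ :=
    hφs.comp (TensorProduct.mk_surjective R A (ResidueField R) Ideal.Quotient.mk_surjective)
  have := (LinearMap.rTensor_surjective E hψ).subsingleton
  exact IsLocalRing.subsingleton_tensorProduct.1 this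

lemma surj_of_lTensor {A X J : Type} [AddCommGroup A] [AddCommGroup X] [AddCommGroup J]
    [Module R A] [Module R X] [Module R J]
    [Module.Finite R A] [Module.Finite R J] [Nontrivial A] (u : X →ₗ[R] J)
    (h : Function.Surjective (u.lTensor A)) : Function.Surjective u := by
  have : Subsingleton (A ⊗[R] (J ⧸ LinearMap.range u)) := by
    refine subsingleton_of_forall_eq 0 fun z => ?_
    obtain ⟨y, rfl⟩ := LinearMap.lTensor_surjective A (LinearMap.range u).mkQ_surjective z
    obtain ⟨x, rfl⟩ := h y
    rw [← LinearMap.comp_apply, ← LinearMap.lTensor_comp, LinearMap.range_mkQ_comp]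
    simp
  have := nakayama_tensor (R := R) (A := A) (E := J ⧸ LinearMap.range u)
  rw [Submodule.Quotient.subsingleton_iff] at this
  exact LinearMap.range_eq_top.1 this

end syz

/-- `A ⊗ P* ≃ Hom(P, A)` -/
noncomputable def theta (A P : Type) [AddCommGroup A] [AddCommGroup P] [Module R A] [Module R P]
    [Module.Finite R P] [Module.Projective R P] : A ⊗[R] Module.Dual R P ≃ₗ[R] (P →ₗ[R] A) :=
  TensorProduct.comm R A (Module.Dual R P) ≪≫ₗ dualTensorHomEquiv R P A

lemma theta_nat {A P Q : Type} [AddCommGroup A] [AddCommGroup P] [Module R A] [Module R P]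
    [Module.Finite R P] [Module.Projective R P] [AddCommGroup Q] [Module R Q]
    [Module.Finite R Q] [Module.Projective R Q] (f : P →ₗ[R] Q) (z : A ⊗[R] Module.Dual R Q) :
    theta A P (f.dualMap.lTensor A z) = theta A Q z ∘ₗ f := by
  induction z with
  | zero => simp
  | add x y hx hy => rw [map_add, map_add, map_add, hx, hy, LinearMap.add_comp]
  | tmul a φ => ext; simp [theta]

end Algebra

/-- Lemma 2.12: if `Tr Ω^m B` is an `r`-th syzygy, `Ω^r A` is Tor-rigid and
`Ext^m(B, A) = 0`, then `Ext^m(B, R) = 0`. -/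
theorem ext_vanishing_lemma
    (R : Type) [CommRing R] [IsNoetherianRing R] [IsLocalRing R]
    (A B : ModuleCat.{0} R) [Module.Finite R A] [Module.Finite R B] [Nontrivial A]
    (m r : ℕ) (hm : 1 ≤ m)
    (C T : ModuleCat.{0} R) (hC : IsNthSyzygyOf R m B C) (hT : IsTransposeOf R C T)
    (hTsyz : ∃ Y W : ModuleCat.{0} R, IsNthSyzygyOf R r Y W ∧ StablyIso R T W)
    (D : ModuleCat.{0} R) (hD : IsNthSyzygyOf R r A D) (hrig : TorRigid R D)
    (hvan : ExtZero R m B A) :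
    ExtZero R m B (ModuleCat.of R R) := by
  obtain ⟨Y, W, hYW, p, q, ⟨eTW⟩⟩ := hTsyz
  obtain ⟨q0, p0, g, f, hg, hfg, -, -, ⟨eT⟩⟩ := hT
  have hfgx : ∀ x, g (f x) = 0 := fun x => by
    have : f x ∈ LinearMap.ker g := hfg ▸ LinearMap.mem_range_self f x
    exact this
  -- `T` and `Y` are finitely generated
  have hTfin : Module.Finite R T := Module.Finite.equiv eT.symm
  have hYfin : Module.Finite R Y := by
    cases r with
    | zero =>
      obtain ⟨e⟩ := hYW
      have h1 : Module.Finite R (W × (Fin q → R)) := Module.Finite.equiv eTW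
      have h2 : Module.Finite R W :=
        Module.Finite.of_surjective (LinearMap.fst R W (Fin q → R)) LinearMap.fst_surjective
      exact Module.Finite.equiv e
    | succ r =>
      obtain ⟨K, ⟨n, g, hg, -⟩, -⟩ := hYW
      exact Module.Finite.of_surjective g hg
  -- the key transfer from `Tor_1` to `Tor_2`
  have transfer : ∀ n, TorZero R (n+1) A T ↔ TorZero R (n+1) D Y := by
    intro n
    rw [tor_nth_left r n A D Y hD, ← tor_nth_right r n Y W A hYW, ← tor_prod A T p n,
      ← tor_prod A W q n]
    exact tor_congr_right (N := ModuleCat.of R (T × (Fin p → R)))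
      (N' := ModuleCat.of R (W × (Fin q → R))) A eTW (n+1)
  have key : TorZero R 1 A T → TorZero R 2 A T := by
    intro h
    exact (transfer 1).2 (hrig Y hYfin 1 le_rfl ((transfer 0).1 h) 2 (by norm_num))
  obtain ⟨m, rfl⟩ : ∃ k, m = k + 1 := ⟨m - 1, by omega⟩
  obtain ⟨K, s, i, gK, hi, hgK, hex, hext⟩ := ext_nth m B C hC
  rw [hext, ext_one i gK _ hi hgK hex] at hvan ⊢
  -- submodules
  let fs := f.dualMap
  let I : ModuleCat.{0} R := ModuleCat.of R (LinearMap.range fs)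
  let J : ModuleCat.{0} R := ModuleCat.of R (LinearMap.ker fs)
  let P0 : ModuleCat.{0} R := ModuleCat.of R (Module.Dual R (Fin q0 → R))
  let P1 : ModuleCat.{0} R := ModuleCat.of R (Module.Dual R (Fin p0 → R))
  have hP0 : Module.Projective R P0 :=
    inferInstanceAs (Module.Projective R (Module.Dual R (Fin q0 → R)))
  have hP1 : Module.Projective R P1 :=
    inferInstanceAs (Module.Projective R (Module.Dual R (Fin p0 → R)))
  let Q : ModuleCat.{0} R := ModuleCat.of R (Module.Dual R (Fin p0 → R) ⧸ LinearMap.range fs)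
  let iI : I →ₗ[R] P1 := (LinearMap.range fs).subtype
  let gI : P1 →ₗ[R] Q := (LinearMap.range fs).mkQ
  let iJ : J →ₗ[R] P0 := (LinearMap.ker fs).subtype
  let gJ : P0 →ₗ[R] I := fs.rangeRestrict
  have hiI : Function.Injective iI := Subtype.val_injective
  have hgI : Function.Surjective gI := Submodule.mkQ_surjective _
  have hI : Function.Exact iI gI := LinearMap.exact_subtype_mkQ _
  have hiJ : Function.Injective iJ := Subtype.val_injective
  have hgJ : Function.Surjective gJ := LinearMap.surjective_rangeRestrict _
  have hJ : Function.Exact iJ gJ := by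
    intro x
    constructor
    · intro hx
      exact ⟨⟨x, congrArg Subtype.val hx⟩, rfl⟩
    · rintro ⟨y, rfl⟩
      exact Subtype.ext y.2
  have t1 : TorZero R 1 A T ↔ Function.Injective (iI.lTensor A) :=
    (tor_congr_right (N := T) (N' := Q) A eT 1).trans (tor_one iI gI A hiI hgI hI)
  have t2 : TorZero R 2 A T ↔ Function.Injective (iJ.lTensor A) :=
    (tor_congr_right (N := T) (N' := Q) A eT 2).trans
      ((tor_shift iI gI A hiI hgI hI 0).trans (tor_one iJ gJ A hiJ hgJ hJ))
  let i' : C →ₗ[R] (Fin s → R) := i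
  let u : Module.Dual R (Fin s → R) →ₗ[R] J :=
    LinearMap.codRestrict (LinearMap.ker fs) (i' ∘ₗ g).dualMap (fun ψ => by
      ext x
      simp [fs, hfgx])
  have hu : iJ ∘ₗ u = (i' ∘ₗ g).dualMap := rfl
  have hfact : ∀ {X : Type} [AddCommGroup X] [Module R X] (φ : (Fin q0 → R) →ₗ[R] X),
      φ ∘ₗ f = 0 → ∃ φ' : C →ₗ[R] X, φ' ∘ₗ g = φ := by
    intro X _ _ φ hφ
    have hle : LinearMap.ker g ≤ LinearMap.ker φ := by
      rw [← hfg]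
      rintro _ ⟨x, rfl⟩
      exact LinearMap.congr_fun hφ x
    refine ⟨(LinearMap.ker g).liftQ φ hle ∘ₗ (g.quotKerEquivOfSurjective hg).symm.toLinearMap, ?_⟩
    ext1 x
    ext
    simp only [LinearMap.comp_apply, LinearEquiv.coe_coe]
    generalize (LinearMap.single R (fun _ => R) x) 1 = y
    have : (g.quotKerEquivOfSurjective hg).symm (g y) = (LinearMap.ker g).mkQ y := by
      rw [LinearEquiv.symm_apply_eq]; rfl
    rw [this]
    exact Submodule.liftQ_apply _ _ _
  have keyX : ∀ x : TensorProduct R A P0, fs.lTensor A x = 0 →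
      ∃ y : TensorProduct R A (Module.Dual R (Fin s → R)), iJ.lTensor A (u.lTensor A y) = x := by
    intro x hx
    have h0 : theta A (Fin q0 → R) x ∘ₗ f = 0 := by
      rw [← theta_nat f x]
      exact (congrArg _ hx).trans (map_zero _)
    obtain ⟨φ, hφ⟩ := hfact _ h0
    obtain ⟨ψ, hψ⟩ := hvan φ
    refine ⟨(theta A (Fin s → R)).symm ψ, ?_⟩
    rw [← LinearMap.comp_apply, ← LinearMap.lTensor_comp, hu]
    apply (theta A (Fin q0 → R)).injective
    refine (theta_nat (i' ∘ₗ g) _).trans ?_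
    rw [LinearEquiv.apply_symm_apply, ← hφ, ← hψ]
    rfl
  have tor1 : TorZero R 1 A T := by
    rw [t1, injective_iff_map_eq_zero]
    intro z hz
    obtain ⟨x, rfl⟩ := LinearMap.lTensor_surjective A hgJ z
    rw [← LinearMap.comp_apply, ← LinearMap.lTensor_comp] at hz
    obtain ⟨y, rfl⟩ := keyX x hz
    rw [← LinearMap.comp_apply, ← LinearMap.lTensor_comp, hJ.linearMap_comp_eq_zero]
    simp
  have inj2 := t2.1 (key tor1)
  have hJfin : Module.Finite R J := inferInstanceAs (Module.Finite R (LinearMap.ker fs))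
  have usurj : Function.Surjective u := by
    refine surj_of_lTensor (R := R) (A := A) (X := Module.Dual R (Fin s → R)) (J := J) u ?_
    intro w
    obtain ⟨y, hy⟩ := keyX (iJ.lTensor A w) (by
      have hc : fs ∘ₗ iJ = 0 := by
        ext1 x
        exact x.2
      have h := LinearMap.lTensor_comp_apply A fs iJ w
      rw [hc] at h
      simpa using h.symm)
    exact ⟨y, inj2 hy⟩
  intro φ
  obtain ⟨ψ, hψ⟩ := usurj ⟨φ ∘ₗ g, by
    ext x
    simp [fs, hfgx]⟩
  refine ⟨ψ, ?_⟩
  have h1 : ψ ∘ₗ i' ∘ₗ g = φ ∘ₗ g := congrArg Subtype.val hψ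
  apply LinearMap.ext
  intro c
  obtain ⟨x, rfl⟩ := hg c
  exact LinearMap.congr_fun h1 x
end
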